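/- Let 𝒳 and 𝒴 be countably generated LFCM spaces such that 𝒜(𝒳) contains a faithful 𝒳-module and 𝒜(𝒴) contains a faithful 𝒴-module, and let F : 𝒜(𝒳) → 𝒜(𝒴) be a *-equivalence of categories. Then for every faithful coarse 𝒳-module C, the coarse 𝒴-module F(C) is faithful. -/

import Mathlib

noncomputable section

open scoped ENNReal

/-! ## Relations -/

/-- Composition of relations: for `R ⊆ Z × Y` and `S ⊆ Y × X`,
`RelComp R S = {(z,x) | ∃ y, (z,y) ∈ R ∧ (y,x) ∈ S}`. -/
def RelComp {X Y Z : Type} (R : Set (Z × Y)) (S : Set (Y × X)) : Set (Z × X) :=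
  {p | ∃ y, (p.1, y) ∈ R ∧ (y, p.2) ∈ S}

/-- Transpose of a relation. -/
def RelTrans {X Y : Type} (R : Set (Y × X)) : Set (X × Y) := {p | (p.2, p.1) ∈ R}

/-! ## Coarse spaces -/

/-- A coarse structure on a set `X`. -/
structure CoarseSpace (X : Type) where
  entourages : Set (Set (X × X))
  diagonal_mem : {p : X × X | p.1 = p.2} ∈ entourages
  mem_of_subset : ∀ {E F : Set (X × X)}, E ∈ entourages → F ⊆ E → F ∈ entourages
  union_mem : ∀ {E F : Set (X × X)}, E ∈ entourages → F ∈ entourages → E ∪ F ∈ entourages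
  transpose_mem : ∀ {E : Set (X × X)}, E ∈ entourages → RelTrans E ∈ entourages
  comp_mem : ∀ {E F : Set (X × X)}, E ∈ entourages → F ∈ entourages → RelComp E F ∈ entourages

namespace CoarseSpace

variable {X Y : Type}

/-- A gauge: a symmetric entourage containing the diagonal. -/
def IsGauge (C : CoarseSpace X) (E : Set (X × X)) : Prop :=
  E ∈ C.entourages ∧ RelTrans E = E ∧ {p : X × X | p.1 = p.2} ⊆ E

/-- The `E`-neighbourhood `E[A]` of a set `A`. -/
def nbhd (E : Set (X × X)) (A : Set X) : Set X := {x | ∃ a ∈ A, (x, a) ∈ E}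

/-- A set is bounded if `A × A` is contained in some entourage. -/
def IsBounded (C : CoarseSpace X) (A : Set X) : Prop := ∃ E ∈ C.entourages, A ×ˢ A ⊆ E

/-- `A ≺ B` : `A` is subordinate to `B`. -/
def Subordinate (C : CoarseSpace X) (A B : Set X) : Prop := ∃ E ∈ C.entourages, A ⊆ nbhd E B

/-- `A ≍ B` : asymptotic equivalence of subsets. -/
def Asymptotic (C : CoarseSpace X) (A B : Set X) : Prop :=
  C.Subordinate A B ∧ C.Subordinate B A

/-- A coarse map between coarse spaces. -/
def IsCoarseMap (CX : CoarseSpace X) (CY : CoarseSpace Y) (f : X → Y) : Prop :=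
  ∀ E ∈ CX.entourages, (fun p : X × X => (f p.1, f p.2)) '' E ∈ CY.entourages

/-- Two maps are close. -/
def Close (CX : CoarseSpace X) (CY : CoarseSpace Y) (f g : X → Y) : Prop :=
  ∀ E ∈ CX.entourages, (fun p : X × X => (f p.1, g p.2)) '' E ∈ CY.entourages

/-- A coarse equivalence (of maps). -/
def IsCoarseEquivMap (CX : CoarseSpace X) (CY : CoarseSpace Y) (f : X → Y) : Prop :=
  IsCoarseMap CX CY f ∧ ∃ g : Y → X, IsCoarseMap CY CX g ∧
    Close CY CY (f ∘ g) id ∧ Close CX CX (g ∘ f) id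

/-- A coarse embedding: a coarse map which is in addition expansive (equivalently, a coarse
equivalence onto its image with the subspace coarse structure). -/
def IsCoarseEmbedding (CX : CoarseSpace X) (CY : CoarseSpace Y) (f : X → Y) : Prop :=
  IsCoarseMap CX CY f ∧
    ∀ F ∈ CY.entourages, {p : X × X | (f p.1, f p.2) ∈ F} ∈ CX.entourages

/-- A coarse structure is countably generated if it is the smallest coarse structure
containing some countable family of subsets of `X × X`. -/
def IsCountablyGenerated (C : CoarseSpace X) : Prop :=
  ∃ G : Set (Set (X × X)), G.Countable ∧ G ⊆ C.entourages ∧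
    ∀ C' : CoarseSpace X, G ⊆ C'.entourages → C.entourages ⊆ C'.entourages

end CoarseSpace

/-- Subordination of relations `R₁, R₂ ⊆ Y × X` with respect to the product coarse structure. -/
def RelSub {X Y : Type} (CX : CoarseSpace X) (CY : CoarseSpace Y)
    (R₁ R₂ : Set (Y × X)) : Prop :=
  ∃ F ∈ CY.entourages, ∃ E ∈ CX.entourages,
    ∀ p ∈ R₁, ∃ q ∈ R₂, (p.1, q.1) ∈ F ∧ (p.2, q.2) ∈ E

/-- Asymptotic equivalence of relations `R₁, R₂ ⊆ Y × X`. -/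
def RelAsymp {X Y : Type} (CX : CoarseSpace X) (CY : CoarseSpace Y)
    (R₁ R₂ : Set (Y × X)) : Prop :=
  RelSub CX CY R₁ R₂ ∧ RelSub CX CY R₂ R₁

/-! ## LFCM spaces -/

/-- A discrete partition of a coarse space endowed with a Boolean algebra `meas` of subsets:
a measurable, locally finite, controlled partition `P` such that a set is measurable iff its
intersection with every block is measurable. -/
structure IsDiscretePartition {X : Type} (C : CoarseSpace X) (meas : Set (Set X))
    (P : Set (Set X)) : Prop where
  nonempty : ∀ A ∈ P, A.Nonempty
  pairwiseDisjoint : ∀ A ∈ P, ∀ B ∈ P, A ≠ B → Disjoint A B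
  covers : ⋃₀ P = Set.univ
  measurable : P ⊆ meas
  locallyFinite : ∀ B : Set X, C.IsBounded B → {A | A ∈ P ∧ (A ∩ B).Nonempty}.Finite
  controlled : ∃ E, C.IsGauge E ∧ ∀ A ∈ P, A ×ˢ A ⊆ E
  meas_iff : ∀ B : Set X, B ∈ meas ↔ ∀ A ∈ P, B ∩ A ∈ meas

/-- A locally finite coarse measurable (LFCM) space: a coarse space together with a Boolean
algebra of subsets admitting a discrete partition (a chosen one is part of the data). -/
structure LFCMSpace (X : Type) where
  coarse : CoarseSpace X
  meas : Set (Set X)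
  empty_mem : ∅ ∈ meas
  compl_mem : ∀ {A : Set X}, A ∈ meas → Aᶜ ∈ meas
  union_mem : ∀ {A B : Set X}, A ∈ meas → B ∈ meas → A ∪ B ∈ meas
  partition : Set (Set X)
  isPartition : IsDiscretePartition coarse meas partition

namespace LFCMSpace

variable {X Y : Type}

/-- The discreteness gauge `E_disc = ⊔_{A ∈ P} A × A` of an LFCM space. -/
def disc (𝒳 : LFCMSpace X) : Set (X × X) := ⋃ A ∈ 𝒳.partition, A ×ˢ A

/-- A discreteness gauge: a gauge bounding the blocks of some discrete partition. -/
def IsDiscretenessGauge (𝒳 : LFCMSpace X) (E : Set (X × X)) : Prop :=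
  𝒳.coarse.IsGauge E ∧
    ∃ P, IsDiscretePartition 𝒳.coarse 𝒳.meas P ∧ ∀ A ∈ P, A ×ˢ A ⊆ E

end LFCMSpace

/-- A coarse measurable map between LFCM spaces. -/
def IsCoarseMeasurableMap {X Y : Type} (𝒳 : LFCMSpace X) (𝒴 : LFCMSpace Y) (f : X → Y) : Prop :=
  CoarseSpace.IsCoarseMap 𝒳.coarse 𝒴.coarse f ∧ ∀ B ∈ 𝒴.meas, f ⁻¹' B ∈ 𝒳.meas

/-! ## Coarse geometric modules -/

/-- A coarse geometric module over an LFCM space `𝒳`: a representation of the Boolean algebra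
of measurable sets by orthogonal projections on a complex Hilbert space, nondegenerate on
bounded sets. -/
structure CoarseModule {X : Type} (𝒳 : LFCMSpace X) (H : Type) [NormedAddCommGroup H]
    [InnerProductSpace ℂ H] [CompleteSpace H] where
  proj : Set X → (H →L[ℂ] H)
  proj_empty : proj ∅ = 0
  proj_selfAdjoint : ∀ A ∈ 𝒳.meas, IsSelfAdjoint (proj A)
  proj_inter : ∀ {A B : Set X}, A ∈ 𝒳.meas → B ∈ 𝒳.meas → proj (A ∩ B) = proj A ∘L proj B
  proj_union : ∀ {A B : Set X}, A ∈ 𝒳.meas → B ∈ 𝒳.meas → Disjoint A B →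
      proj (A ∪ B) = proj A + proj B
  nondeg : Dense (↑(Submodule.span ℂ
      (⋃ A ∈ {A | A ∈ 𝒳.meas ∧ 𝒳.coarse.IsBounded A}, Set.range (proj A))) : Set H)

variable {X Y Z : Type}
variable {H₀ H₁ H₂ H₃ : Type}

/-- The support of a bounded operator between Hilbert spaces carrying representations
`pX`, `pY` of the measurable sets of LFCM spaces `𝒳` (source) and `𝒴` (target). -/
def opSupp [NormedAddCommGroup H₁] [InnerProductSpace ℂ H₁]
    [NormedAddCommGroup H₂] [InnerProductSpace ℂ H₂]
    (𝒳 : LFCMSpace X) (𝒴 : LFCMSpace Y)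
    (pX : Set X → (H₁ →L[ℂ] H₁)) (pY : Set Y → (H₂ →L[ℂ] H₂))
    (t : H₁ →L[ℂ] H₂) : Set (Y × X) :=
  ⋃₀ {S | ∃ B A, S = B ×ˢ A ∧ B ∈ 𝒴.meas ∧ B ×ˢ B ⊆ 𝒴.disc ∧
      A ∈ 𝒳.meas ∧ A ×ˢ A ⊆ 𝒳.disc ∧ pY B ∘L t ∘L pX A ≠ 0}

/-- Controlled propagation of an operator between modules over the same LFCM space. -/
def HasControlledPropagation [NormedAddCommGroup H₁] [InnerProductSpace ℂ H₁]
    [NormedAddCommGroup H₂] [InnerProductSpace ℂ H₂]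
    (𝒳 : LFCMSpace X) (pX : Set X → (H₁ →L[ℂ] H₁)) (pY : Set X → (H₂ →L[ℂ] H₂))
    (t : H₁ →L[ℂ] H₂) : Prop :=
  opSupp 𝒳 𝒳 pX pY t ∈ 𝒳.coarse.entourages

/-- Approximable operators: norm-limits of controlled propagation operators. -/
def Approximable [NormedAddCommGroup H₁] [InnerProductSpace ℂ H₁]
    [NormedAddCommGroup H₂] [InnerProductSpace ℂ H₂]
    (𝒳 : LFCMSpace X) (pX : Set X → (H₁ →L[ℂ] H₁)) (pY : Set X → (H₂ →L[ℂ] H₂))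
    (t : H₁ →L[ℂ] H₂) : Prop :=
  ∀ ε : ℝ, 0 < ε → ∃ s : H₁ →L[ℂ] H₂, HasControlledPropagation 𝒳 pX pY s ∧ ‖t - s‖ ≤ ε

/-- The rank (Hilbert dimension of the range) of an operator. -/
def projRank {H : Type} [NormedAddCommGroup H] [InnerProductSpace ℂ H]
    (p : H →L[ℂ] H) : Cardinal :=
  LinearMap.rank (p : H →ₗ[ℂ] H)

/-- The `κ`-domain of a coarse module, computed with respect to an arbitrary gauge `E`. -/
def domKappaAt {X : Type} {H : Type} [NormedAddCommGroup H] [InnerProductSpace ℂ H]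
    [CompleteSpace H] (𝒳 : LFCMSpace X) (M : CoarseModule 𝒳 H) (E : Set (X × X))
    (κ : Cardinal) : Set X :=
  ⋃₀ {A | A ∈ 𝒳.meas ∧ A ×ˢ A ⊆ E ∧ κ ≤ projRank (M.proj A)}

/-- The `κ`-domain of a coarse module (with respect to the discreteness gauge). -/
def domKappa {X : Type} {H : Type} [NormedAddCommGroup H] [InnerProductSpace ℂ H]
    [CompleteSpace H] (𝒳 : LFCMSpace X) (M : CoarseModule 𝒳 H) (κ : Cardinal) : Set X :=
  domKappaAt 𝒳 M 𝒳.disc κ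

/-- A coarse module is faithful if its faithfulness domain is asymptotic to the whole space. -/
def IsFaithfulMod {X : Type} {H : Type} [NormedAddCommGroup H] [InnerProductSpace ℂ H]
    [CompleteSpace H] (𝒳 : LFCMSpace X) (M : CoarseModule 𝒳 H) : Prop :=
  𝒳.coarse.Asymptotic (domKappa 𝒳 M 1) Set.univ

/-- A coarse module is ample if its ampleness domain is asymptotic to the whole space. -/
def IsAmpleMod {X : Type} {H : Type} [NormedAddCommGroup H] [InnerProductSpace ℂ H]
    [CompleteSpace H] (𝒳 : LFCMSpace X) (M : CoarseModule 𝒳 H) : Prop :=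
  𝒳.coarse.Asymptotic (domKappa 𝒳 M Cardinal.aleph0) Set.univ

/-- The approximate relation `f^T_{δ,F,E}` of a bounded operator. -/
def approxRel [NormedAddCommGroup H₁] [InnerProductSpace ℂ H₁]
    [NormedAddCommGroup H₂] [InnerProductSpace ℂ H₂]
    (𝒳 : LFCMSpace X) (𝒴 : LFCMSpace Y)
    (pX : Set X → (H₁ →L[ℂ] H₁)) (pY : Set Y → (H₂ →L[ℂ] H₂))
    (T : H₁ →L[ℂ] H₂) (δ : ℝ) (F : Set (Y × Y)) (E : Set (X × X)) : Set (Y × X) :=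
  ⋃₀ {S | ∃ B A, S = B ×ˢ A ∧ B ∈ 𝒴.meas ∧ B ×ˢ B ⊆ F ∧
      A ∈ 𝒳.meas ∧ A ×ˢ A ⊆ E ∧ δ < ‖pY B ∘L T ∘L pX A‖}

/-- A unitary operator between Hilbert spaces. -/
def IsUnitaryOp [NormedAddCommGroup H₁] [InnerProductSpace ℂ H₁] [CompleteSpace H₁]
    [NormedAddCommGroup H₂] [InnerProductSpace ℂ H₂] [CompleteSpace H₂]
    (U : H₁ →L[ℂ] H₂) : Prop :=
  ContinuousLinearMap.adjoint U ∘L U = ContinuousLinearMap.id ℂ H₁ ∧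
    U ∘L ContinuousLinearMap.adjoint U = ContinuousLinearMap.id ℂ H₂

/-- A central unitary of the C*-algebra of approximable operators on a coarse module. -/
def IsCentralUnitary {X : Type} {H : Type} [NormedAddCommGroup H] [InnerProductSpace ℂ H]
    [CompleteSpace H] (𝒳 : LFCMSpace X) (M : CoarseModule 𝒳 H) (u : H →L[ℂ] H) : Prop :=
  Approximable 𝒳 M.proj M.proj u ∧ IsUnitaryOp u ∧
    ∀ t : H →L[ℂ] H, Approximable 𝒳 M.proj M.proj t → u ∘L t = t ∘L u

/-- Equivalence of operators modulo central unitaries. -/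
def CongruentModCentral {X : Type} [NormedAddCommGroup H₁] [InnerProductSpace ℂ H₁]
    [CompleteSpace H₁] [NormedAddCommGroup H₂] [InnerProductSpace ℂ H₂] [CompleteSpace H₂]
    (𝒳 : LFCMSpace X) (C : CoarseModule 𝒳 H₁) (D : CoarseModule 𝒳 H₂)
    (t s : H₁ →L[ℂ] H₂) : Prop :=
  ∃ u v, IsCentralUnitary 𝒳 C u ∧ IsCentralUnitary 𝒳 D v ∧ t = v ∘L s ∘L u

/-! ## Direct sums of modules -/

/-- The direct sum `T ⊕ S` of two operators, on the `ℓ²`-product of Hilbert spaces. -/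
def prodOp [NormedAddCommGroup H₀] [InnerProductSpace ℂ H₀]
    [NormedAddCommGroup H₁] [InnerProductSpace ℂ H₁]
    [NormedAddCommGroup H₂] [InnerProductSpace ℂ H₂]
    [NormedAddCommGroup H₃] [InnerProductSpace ℂ H₃]
    (T : H₀ →L[ℂ] H₂) (S : H₁ →L[ℂ] H₃) :
    WithLp 2 (H₀ × H₁) →L[ℂ] WithLp 2 (H₂ × H₃) :=
  (WithLp.prodContinuousLinearEquiv 2 ℂ H₂ H₃).symm.toContinuousLinearMap ∘L
    (T.prodMap S) ∘L (WithLp.prodContinuousLinearEquiv 2 ℂ H₀ H₁).toContinuousLinearMap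

/-- The canonical inclusion `H₀ → H₀ ⊕ H₁`. -/
def inlOp (H₀ H₁ : Type) [NormedAddCommGroup H₀] [InnerProductSpace ℂ H₀]
    [NormedAddCommGroup H₁] [InnerProductSpace ℂ H₁] :
    H₀ →L[ℂ] WithLp 2 (H₀ × H₁) :=
  (WithLp.prodContinuousLinearEquiv 2 ℂ H₀ H₁).symm.toContinuousLinearMap ∘L
    ContinuousLinearMap.inl ℂ H₀ H₁

/-- The canonical inclusion `H₁ → H₀ ⊕ H₁`. -/
def inrOp (H₀ H₁ : Type) [NormedAddCommGroup H₀] [InnerProductSpace ℂ H₀]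
    [NormedAddCommGroup H₁] [InnerProductSpace ℂ H₁] :
    H₁ →L[ℂ] WithLp 2 (H₀ × H₁) :=
  (WithLp.prodContinuousLinearEquiv 2 ℂ H₀ H₁).symm.toContinuousLinearMap ∘L
    ContinuousLinearMap.inr ℂ H₀ H₁

/-- The canonical projection `H₀ ⊕ H₁ → H₀`. -/
def fstOp (H₀ H₁ : Type) [NormedAddCommGroup H₀] [InnerProductSpace ℂ H₀]
    [NormedAddCommGroup H₁] [InnerProductSpace ℂ H₁] :
    WithLp 2 (H₀ × H₁) →L[ℂ] H₀ :=
  ContinuousLinearMap.fst ℂ H₀ H₁ ∘L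
    (WithLp.prodContinuousLinearEquiv 2 ℂ H₀ H₁).toContinuousLinearMap

/-- The canonical projection `H₀ ⊕ H₁ → H₁`. -/
def sndOp (H₀ H₁ : Type) [NormedAddCommGroup H₀] [InnerProductSpace ℂ H₀]
    [NormedAddCommGroup H₁] [InnerProductSpace ℂ H₁] :
    WithLp 2 (H₀ × H₁) →L[ℂ] H₁ :=
  ContinuousLinearMap.snd ℂ H₀ H₁ ∘L
    (WithLp.prodContinuousLinearEquiv 2 ℂ H₀ H₁).toContinuousLinearMap

/-- `M` is the direct sum of the coarse modules `C₀` and `C₁`. -/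
def IsDirectSum {X : Type} [NormedAddCommGroup H₀] [InnerProductSpace ℂ H₀] [CompleteSpace H₀]
    [NormedAddCommGroup H₁] [InnerProductSpace ℂ H₁] [CompleteSpace H₁]
    (𝒳 : LFCMSpace X) (C₀ : CoarseModule 𝒳 H₀) (C₁ : CoarseModule 𝒳 H₁)
    (M : CoarseModule 𝒳 (WithLp 2 (H₀ × H₁))) : Prop :=
  ∀ A : Set X, M.proj A = prodOp (C₀.proj A) (C₁.proj A)

/-! ## Bundled modules and *-functors -/

/-- A coarse module over `𝒳` bundled together with its Hilbert space; the objects of the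
approximable category `𝒜(𝒳)`. -/
structure BundledModule {X : Type} (𝒳 : LFCMSpace X) where
  H : Type
  [instNorm : NormedAddCommGroup H]
  [instInner : InnerProductSpace ℂ H]
  [instComplete : CompleteSpace H]
  mod : CoarseModule 𝒳 H

attribute [instance] BundledModule.instNorm BundledModule.instInner BundledModule.instComplete

/-- A *-functor `𝒜(𝒳) → 𝒜(𝒴)` between approximable categories: a map on objects together
with a ℂ-linear, multiplicative, adjoint-preserving map on approximable operators. -/
structure StarFunctor {X Y : Type} (𝒳 : LFCMSpace X) (𝒴 : LFCMSpace Y) where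
  obj : BundledModule 𝒳 → BundledModule 𝒴
  map : ∀ {C D : BundledModule 𝒳} (t : C.H →L[ℂ] D.H),
      Approximable 𝒳 C.mod.proj D.mod.proj t → ((obj C).H →L[ℂ] (obj D).H)
  map_approximable : ∀ {C D : BundledModule 𝒳} (t : C.H →L[ℂ] D.H)
      (ht : Approximable 𝒳 C.mod.proj D.mod.proj t),
      Approximable 𝒴 (obj C).mod.proj (obj D).mod.proj (map t ht)
  map_id : ∀ (C : BundledModule 𝒳)
      (h : Approximable 𝒳 C.mod.proj C.mod.proj (ContinuousLinearMap.id ℂ C.H)),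
      map (ContinuousLinearMap.id ℂ C.H) h = ContinuousLinearMap.id ℂ (obj C).H
  map_comp : ∀ {C D G : BundledModule 𝒳} (t : C.H →L[ℂ] D.H) (s : D.H →L[ℂ] G.H)
      (ht : Approximable 𝒳 C.mod.proj D.mod.proj t)
      (hs : Approximable 𝒳 D.mod.proj G.mod.proj s)
      (hst : Approximable 𝒳 C.mod.proj G.mod.proj (s ∘L t)),
      map (s ∘L t) hst = map s hs ∘L map t ht
  map_add : ∀ {C D : BundledModule 𝒳} (t s : C.H →L[ℂ] D.H)
      (ht : Approximable 𝒳 C.mod.proj D.mod.proj t)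
      (hs : Approximable 𝒳 C.mod.proj D.mod.proj s)
      (hts : Approximable 𝒳 C.mod.proj D.mod.proj (t + s)),
      map (t + s) hts = map t ht + map s hs
  map_smul : ∀ {C D : BundledModule 𝒳} (c : ℂ) (t : C.H →L[ℂ] D.H)
      (ht : Approximable 𝒳 C.mod.proj D.mod.proj t)
      (hct : Approximable 𝒳 C.mod.proj D.mod.proj (c • t)),
      map (c • t) hct = c • map t ht
  map_star : ∀ {C D : BundledModule 𝒳} (t : C.H →L[ℂ] D.H)
      (ht : Approximable 𝒳 C.mod.proj D.mod.proj t)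
      (hstar : Approximable 𝒳 D.mod.proj C.mod.proj (ContinuousLinearMap.adjoint t)),
      map (ContinuousLinearMap.adjoint t) hstar = ContinuousLinearMap.adjoint (map t ht)

namespace StarFunctor

variable {𝒳 : LFCMSpace X} {𝒴 : LFCMSpace Y}

/-- A full functor. -/
def Full (F : StarFunctor 𝒳 𝒴) : Prop :=
  ∀ (C D : BundledModule 𝒳) (s : (F.obj C).H →L[ℂ] (F.obj D).H),
    Approximable 𝒴 (F.obj C).mod.proj (F.obj D).mod.proj s →
    ∃ (t : C.H →L[ℂ] D.H) (ht : Approximable 𝒳 C.mod.proj D.mod.proj t), F.map t ht = s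

/-- A faithful functor. -/
def Faithful (F : StarFunctor 𝒳 𝒴) : Prop :=
  ∀ (C D : BundledModule 𝒳) (t t' : C.H →L[ℂ] D.H)
    (ht : Approximable 𝒳 C.mod.proj D.mod.proj t)
    (ht' : Approximable 𝒳 C.mod.proj D.mod.proj t'),
    F.map t ht = F.map t' ht' → t = t'

/-- An essentially surjective functor (up to isomorphism in the approximable category). -/
def EssSurj (F : StarFunctor 𝒳 𝒴) : Prop :=
  ∀ D' : BundledModule 𝒴, ∃ C : BundledModule 𝒳,
    ∃ u : (F.obj C).H →L[ℂ] D'.H, Approximable 𝒴 (F.obj C).mod.proj D'.mod.proj u ∧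
    ∃ v : D'.H →L[ℂ] (F.obj C).H, Approximable 𝒴 D'.mod.proj (F.obj C).mod.proj v ∧
      v ∘L u = ContinuousLinearMap.id ℂ (F.obj C).H ∧
      u ∘L v = ContinuousLinearMap.id ℂ D'.H

/-- A unitary `U` implements the *-isomorphism induced by `F` on the endomorphism algebra of
a module `C`. -/
def Implements (F : StarFunctor 𝒳 𝒴) (C : BundledModule 𝒳)
    (U : C.H →L[ℂ] (F.obj C).H) : Prop :=
  IsUnitaryOp U ∧ ∀ (t : C.H →L[ℂ] C.H) (ht : Approximable 𝒳 C.mod.proj C.mod.proj t),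
    F.map t ht = U ∘L t ∘L ContinuousLinearMap.adjoint U

end StarFunctor

/-- The graph of a map, as a relation `⊆ Y × X`. -/
def mapGraph {X Y : Type} (f : X → Y) : Set (Y × X) := {p | p.1 = f p.2}

/-- A relation `R ⊆ Y × X` is a coarse equivalence from `DX ⊆ X` to `DY ⊆ Y` (each with the
subspace coarse structure): controlled in both directions, densely defined and coarsely
surjective relative to `DX` and `DY`. -/
def IsRelCoarseEquivOn {X Y : Type} (CX : CoarseSpace X) (CY : CoarseSpace Y)
    (DX : Set X) (DY : Set Y) (R : Set (Y × X)) : Prop :=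
  (∀ E ∈ CX.entourages, RelComp R (RelComp E (RelTrans R)) ∈ CY.entourages) ∧
  (∀ F ∈ CY.entourages, RelComp (RelTrans R) (RelComp F R) ∈ CX.entourages) ∧
  CX.Asymptotic (Prod.snd '' R) DX ∧ CY.Asymptotic (Prod.fst '' R) DY

/-- `S ⊆ X × Y` is a coarse inverse of the relation `R ⊆ Y × X` between `DX` and `DY`:
both compositions are asymptotic to the respective (restricted) diagonals. -/
def IsRelCoarseInverseOn {X Y : Type} (CX : CoarseSpace X) (CY : CoarseSpace Y)
    (DX : Set X) (DY : Set Y) (R : Set (Y × X)) (S : Set (X × Y)) : Prop :=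
  RelAsymp CX CX (RelComp S R) {p : X × X | p.1 = p.2 ∧ p.1 ∈ DX} ∧
  RelAsymp CY CY (RelComp R S) {p : Y × Y | p.1 = p.2 ∧ p.1 ∈ DY}

/-- The statement that a coarse map `f` represents the coarse embedding induced by a full and
faithful *-functor `F` via approximate relations of implementing unitaries. -/
def RepresentsInducedEmbedding {X Y : Type} {𝒳 : LFCMSpace X} {𝒴 : LFCMSpace Y}
    (F : StarFunctor 𝒳 𝒴) (f : X → Y) : Prop :=
  ∀ (C : BundledModule 𝒳), IsFaithfulMod 𝒳 C.mod →
  ∀ (U : C.H →L[ℂ] (F.obj C).H), F.Implements C U →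
  ∀ δ : ℝ, 0 < δ → δ < 1 →
  ∃ F₀ ∈ 𝒴.coarse.entourages, ∃ E₀ ∈ 𝒳.coarse.entourages,
    ∀ F' ∈ 𝒴.coarse.entourages, F₀ ⊆ F' → ∀ E ∈ 𝒳.coarse.entourages, E₀ ⊆ E →
      RelAsymp 𝒳.coarse 𝒴.coarse
        (approxRel 𝒳 𝒴 C.mod.proj (F.obj C).mod.proj U δ F' E) (mapGraph f)

/-- Bundle a coarse module into an object of the approximable category. -/
abbrev BundledModule.ofModule {X : Type} {𝒳 : LFCMSpace X} {H : Type} [NormedAddCommGroup H]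
    [InnerProductSpace ℂ H] [CompleteSpace H] (M : CoarseModule 𝒳 H) : BundledModule 𝒳 :=
  ⟨H, M⟩

theorem LFCMSpace.disc_mem {X : Type} (𝒳 : LFCMSpace X) :
    𝒳.disc ∈ 𝒳.coarse.entourages := by
  obtain ⟨E, hE, hEP⟩ := 𝒳.isPartition.controlled
  refine 𝒳.coarse.mem_of_subset hE.1 ?_
  intro p hp
  simp only [LFCMSpace.disc, Set.mem_iUnion] at hp
  obtain ⟨A, hA, hpA⟩ := hp
  exact hEP A hA hpA

theorem prodOp_comp_inlOp {H₀ H₁ H₂ H₃ : Type}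
    [NormedAddCommGroup H₀] [InnerProductSpace ℂ H₀]
    [NormedAddCommGroup H₁] [InnerProductSpace ℂ H₁]
    [NormedAddCommGroup H₂] [InnerProductSpace ℂ H₂]
    [NormedAddCommGroup H₃] [InnerProductSpace ℂ H₃]
    (T : H₀ →L[ℂ] H₂) (S : H₁ →L[ℂ] H₃) :
    prodOp T S ∘L inlOp H₀ H₁ = inlOp H₂ H₃ ∘L T := by
  ext x
  simp [prodOp, inlOp]

theorem prodOp_comp_inrOp {H₀ H₁ H₂ H₃ : Type}
    [NormedAddCommGroup H₀] [InnerProductSpace ℂ H₀]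
    [NormedAddCommGroup H₁] [InnerProductSpace ℂ H₁]
    [NormedAddCommGroup H₂] [InnerProductSpace ℂ H₂]
    [NormedAddCommGroup H₃] [InnerProductSpace ℂ H₃]
    (T : H₀ →L[ℂ] H₂) (S : H₁ →L[ℂ] H₃) :
    prodOp T S ∘L inrOp H₀ H₁ = inrOp H₂ H₃ ∘L S := by
  ext x
  simp [prodOp, inrOp]

/-- The canonical inclusion into a direct sum of coarse modules is approximable
(indeed it has controlled propagation). -/
theorem IsDirectSum.approximable_inl {X : Type} {H₀ H₁ : Type}
    [NormedAddCommGroup H₀] [InnerProductSpace ℂ H₀] [CompleteSpace H₀]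
    [NormedAddCommGroup H₁] [InnerProductSpace ℂ H₁] [CompleteSpace H₁]
    {𝒳 : LFCMSpace X} {C₀ : CoarseModule 𝒳 H₀} {C₁ : CoarseModule 𝒳 H₁}
    {M : CoarseModule 𝒳 (WithLp 2 (H₀ × H₁))} (hM : IsDirectSum 𝒳 C₀ C₁ M) :
    Approximable 𝒳 C₀.proj M.proj (inlOp H₀ H₁) := by
  intro ε hε
  refine ⟨inlOp H₀ H₁, ?_, by simp [hε.le]⟩
  refine 𝒳.coarse.mem_of_subset (𝒳.coarse.comp_mem 𝒳.disc_mem 𝒳.disc_mem) ?_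
  rintro ⟨y, x⟩ hyx
  obtain ⟨s, ⟨B, A, rfl, hBmeas, hBb, hAmeas, hAb, hne⟩, hmem⟩ := hyx
  have key : M.proj B ∘L inlOp H₀ H₁ ∘L C₀.proj A
      = inlOp H₀ H₁ ∘L C₀.proj (B ∩ A) := by
    rw [C₀.proj_inter hBmeas hAmeas, hM B, ← ContinuousLinearMap.comp_assoc,
      prodOp_comp_inlOp, ContinuousLinearMap.comp_assoc]
  have hBA : (B ∩ A).Nonempty := by
    by_contra h
    rw [Set.not_nonempty_iff_eq_empty] at h
    apply hne
    rw [key, h, C₀.proj_empty]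
    ext z
    simp
  obtain ⟨z, hzB, hzA⟩ := hBA
  obtain ⟨hyB, hxA⟩ := hmem
  exact ⟨z, hBb ⟨hyB, hzB⟩, hAb ⟨hzA, hxA⟩⟩

theorem IsDirectSum.approximable_inr {X : Type} {H₀ H₁ : Type}
    [NormedAddCommGroup H₀] [InnerProductSpace ℂ H₀] [CompleteSpace H₀]
    [NormedAddCommGroup H₁] [InnerProductSpace ℂ H₁] [CompleteSpace H₁]
    {𝒳 : LFCMSpace X} {C₀ : CoarseModule 𝒳 H₀} {C₁ : CoarseModule 𝒳 H₁}
    {M : CoarseModule 𝒳 (WithLp 2 (H₀ × H₁))} (hM : IsDirectSum 𝒳 C₀ C₁ M) :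
    Approximable 𝒳 C₁.proj M.proj (inrOp H₀ H₁) := by
  intro ε hε
  refine ⟨inrOp H₀ H₁, ?_, by simp [hε.le]⟩
  refine 𝒳.coarse.mem_of_subset (𝒳.coarse.comp_mem 𝒳.disc_mem 𝒳.disc_mem) ?_
  rintro ⟨y, x⟩ hyx
  obtain ⟨s, ⟨B, A, rfl, hBmeas, hBb, hAmeas, hAb, hne⟩, hmem⟩ := hyx
  have key : M.proj B ∘L inrOp H₀ H₁ ∘L C₁.proj A
      = inrOp H₀ H₁ ∘L C₁.proj (B ∩ A) := by
    rw [C₁.proj_inter hBmeas hAmeas, hM B, ← ContinuousLinearMap.comp_assoc,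
      prodOp_comp_inrOp, ContinuousLinearMap.comp_assoc]
  have hBA : (B ∩ A).Nonempty := by
    by_contra h
    rw [Set.not_nonempty_iff_eq_empty] at h
    apply hne
    rw [key, h, C₁.proj_empty]
    ext z
    simp
  obtain ⟨z, hzB, hzA⟩ := hBA
  obtain ⟨hyB, hxA⟩ := hmem
  exact ⟨z, hBb ⟨hyB, hzB⟩, hAb ⟨hzA, hxA⟩⟩

section Preparations

open InnerProductSpace Filter Topology

/-! ## Sets and entourages of an LFCM space -/

namespace LFCMSpace

variable {X : Type} (𝒳 : LFCMSpace X)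

/-- A measurable set bounded by the discreteness gauge. -/
def IsDiscBounded (A : Set X) : Prop := A ∈ 𝒳.meas ∧ A ×ˢ A ⊆ 𝒳.disc

theorem biUnion_mem {ι : Type} (I : Finset ι) {W : ι → Set X} (hW : ∀ i ∈ I, W i ∈ 𝒳.meas) :
    (⋃ i ∈ I, W i) ∈ 𝒳.meas := by
  classical
  induction I using Finset.induction_on with
  | empty => simpa using 𝒳.empty_mem
  | insert a s ha ih =>
    rw [Finset.set_biUnion_insert]
    exact 𝒳.union_mem (hW a (by simp)) (ih fun i hi => hW i (by simp [hi]))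

theorem exists_block (x : X) : ∃ A ∈ 𝒳.partition, x ∈ A := by
  have h : x ∈ ⋃₀ 𝒳.partition := by rw [𝒳.isPartition.covers]; trivial
  simpa using h

theorem mem_disc {x y : X} : (x, y) ∈ 𝒳.disc ↔ ∃ A ∈ 𝒳.partition, x ∈ A ∧ y ∈ A := by
  simp [disc, and_left_comm]

theorem block_eq {A B : Set X} (hA : A ∈ 𝒳.partition) (hB : B ∈ 𝒳.partition) {x : X}
    (hxA : x ∈ A) (hxB : x ∈ B) : A = B := by
  by_contra h
  exact Set.disjoint_left.1 (𝒳.isPartition.pairwiseDisjoint A hA B hB h) hxA hxB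

theorem disc_refl (x : X) : (x, x) ∈ 𝒳.disc := by
  obtain ⟨A, hA, hx⟩ := 𝒳.exists_block x
  exact 𝒳.mem_disc.2 ⟨A, hA, hx, hx⟩

theorem disc_symm {x y : X} (h : (x, y) ∈ 𝒳.disc) : (y, x) ∈ 𝒳.disc := by
  obtain ⟨A, hA, hx, hy⟩ := 𝒳.mem_disc.1 h
  exact 𝒳.mem_disc.2 ⟨A, hA, hy, hx⟩

theorem disc_trans {x y z : X} (h : (x, y) ∈ 𝒳.disc) (h' : (y, z) ∈ 𝒳.disc) :
    (x, z) ∈ 𝒳.disc := by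
  obtain ⟨A, hA, hx, hy⟩ := 𝒳.mem_disc.1 h
  obtain ⟨B, hB, hy', hz⟩ := 𝒳.mem_disc.1 h'
  obtain rfl := 𝒳.block_eq hA hB hy hy'
  exact 𝒳.mem_disc.2 ⟨A, hA, hx, hz⟩

theorem isDiscBounded_of_mem_partition {A : Set X} (hA : A ∈ 𝒳.partition) :
    𝒳.IsDiscBounded A :=
  ⟨𝒳.isPartition.measurable hA, fun _ hp => 𝒳.mem_disc.2 ⟨A, hA, hp.1, hp.2⟩⟩

/-- The disc-thickening of an entourage on both sides. -/
theorem disc_comp_mem {E : Set (X × X)} (hE : E ∈ 𝒳.coarse.entourages) :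
    RelComp 𝒳.disc (RelComp E 𝒳.disc) ∈ 𝒳.coarse.entourages :=
  𝒳.coarse.comp_mem 𝒳.disc_mem (𝒳.coarse.comp_mem hE 𝒳.disc_mem)

theorem prod_subset_disc_comp {E : Set (X × X)} {B A : Set X} (hB : 𝒳.IsDiscBounded B)
    (hA : 𝒳.IsDiscBounded A) {b a : X} (hb : b ∈ B) (ha : a ∈ A) (h : (b, a) ∈ E) :
    B ×ˢ A ⊆ RelComp 𝒳.disc (RelComp E 𝒳.disc) :=
  fun _ hp => ⟨b, hB.2 ⟨hp.1, hb⟩, a, h, hA.2 ⟨ha, hp.2⟩⟩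

/-- A countably generated coarse structure has a cofinal increasing sequence of symmetric
entourages containing the discreteness gauge. -/
theorem exists_cofinal_seq (h : 𝒳.coarse.IsCountablyGenerated) :
    ∃ E : ℕ → Set (X × X), (∀ n, E n ∈ 𝒳.coarse.entourages) ∧ Monotone E ∧
      (∀ n, 𝒳.disc ⊆ E n) ∧ (∀ n x y, (x, y) ∈ E n → (y, x) ∈ E n) ∧
      ∀ F ∈ 𝒳.coarse.entourages, ∃ n, F ⊆ E n := by
  obtain ⟨G, hGc, hG, hmin⟩ := h
  obtain ⟨g, hg⟩ : ∃ g : ℕ → Set (X × X), insert 𝒳.disc G = Set.range g :=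
    (hGc.insert _).exists_eq_range (Set.insert_nonempty _ _)
  have hgm : ∀ n, g n ∈ 𝒳.coarse.entourages := fun n => by
    have : g n ∈ insert 𝒳.disc G := hg ▸ Set.mem_range_self n
    rcases this with h | h
    · exact h ▸ 𝒳.disc_mem
    · exact hG h
  let step : Set (X × X) → Set (X × X) → Set (X × X) := fun S T =>
    RelComp (S ∪ (T ∪ RelTrans T)) (S ∪ (T ∪ RelTrans T))
  let E : ℕ → Set (X × X) := fun n => Nat.rec 𝒳.disc (fun k S => step S (g k)) n
  have hEs : ∀ n, E (n + 1) = step (E n) (g n) := fun n => rfl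
  have hEm : ∀ n, E n ∈ 𝒳.coarse.entourages := by
    intro n
    induction n with
    | zero => exact 𝒳.disc_mem
    | succ k ih =>
      have := 𝒳.coarse.union_mem ih
        (𝒳.coarse.union_mem (hgm k) (𝒳.coarse.transpose_mem (hgm k)))
      exact 𝒳.coarse.comp_mem this this
  have hdisc : ∀ n, 𝒳.disc ⊆ E n := by
    intro n
    induction n with
    | zero => exact subset_rfl
    | succ k ih =>
      rintro ⟨x, y⟩ hp
      exact ⟨y, Or.inl (ih hp), Or.inl (ih (𝒳.disc_refl y))⟩
  have hU : ∀ n, E n ∪ (g n ∪ RelTrans (g n)) ⊆ E (n + 1) := by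
    rintro n ⟨x, y⟩ hp
    exact ⟨y, hp, Or.inl (hdisc n (𝒳.disc_refl y))⟩
  have hmono : Monotone E := monotone_nat_of_le_succ fun n => Set.subset_union_left.trans (hU n)
  have hsymm : ∀ n x y, (x, y) ∈ E n → (y, x) ∈ E n := by
    intro n
    induction n with
    | zero => exact fun x y h => 𝒳.disc_symm h
    | succ k ih =>
      have key : ∀ x y, (x, y) ∈ E k ∪ (g k ∪ RelTrans (g k)) →
          (y, x) ∈ E k ∪ (g k ∪ RelTrans (g k)) := by
        rintro x y (h | h | h)
        · exact Or.inl (ih _ _ h)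
        · exact Or.inr (Or.inr h)
        · exact Or.inr (Or.inl h)
      rintro x y ⟨z, h1, h2⟩
      exact ⟨z, key _ _ h2, key _ _ h1⟩
  refine ⟨E, hEm, hmono, hdisc, hsymm, ?_⟩
  let C' : CoarseSpace X :=
    { entourages := {F | ∃ n, F ⊆ E n}
      diagonal_mem := ⟨0, fun p hp => by
        obtain ⟨x, y⟩ := p
        obtain rfl : x = y := hp
        exact 𝒳.disc_refl x⟩
      mem_of_subset := fun ⟨n, hn⟩ h => ⟨n, h.trans hn⟩
      union_mem := fun ⟨n, hn⟩ ⟨m, hm⟩ => ⟨max n m, Set.union_subset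
        (hn.trans (hmono (le_max_left _ _))) (hm.trans (hmono (le_max_right _ _)))⟩
      transpose_mem := fun ⟨n, hn⟩ => ⟨n, fun p hp => hsymm n _ _ (hn hp)⟩
      comp_mem := fun ⟨n, hn⟩ ⟨m, hm⟩ => ⟨max n m + 1, fun p ⟨y, h1, h2⟩ =>
        ⟨y, Or.inl (hmono (le_max_left _ _) (hn h1)), Or.inl (hmono (le_max_right _ _) (hm h2))⟩⟩ }
  refine fun F hF => hmin C' (fun T hT => ?_) hF
  obtain ⟨n, hn⟩ : T ∈ Set.range g := hg ▸ Or.inr hT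
  exact ⟨n + 1, hn ▸ (Set.subset_union_left.trans Set.subset_union_right).trans (hU n)⟩

end LFCMSpace

/-! ## Projections of a coarse module -/

namespace CoarseModule

variable {X : Type} {𝒳 : LFCMSpace X} {H : Type} [NormedAddCommGroup H]
  [InnerProductSpace ℂ H] [CompleteSpace H] (M : CoarseModule 𝒳 H)

theorem proj_proj {A B : Set X} (hA : A ∈ 𝒳.meas) (hB : B ∈ 𝒳.meas) (v : H) :
    M.proj A (M.proj B v) = M.proj (A ∩ B) v := by
  rw [M.proj_inter hA hB]; rfl

theorem proj_proj_of_subset {A B : Set X} (hA : A ∈ 𝒳.meas) (hB : B ∈ 𝒳.meas) (h : A ⊆ B)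
    (v : H) : M.proj A (M.proj B v) = M.proj A v := by
  rw [M.proj_proj hA hB, Set.inter_eq_left.2 h]

theorem proj_proj_of_superset {A B : Set X} (hA : A ∈ 𝒳.meas) (hB : B ∈ 𝒳.meas) (h : B ⊆ A)
    (v : H) : M.proj A (M.proj B v) = M.proj B v := by
  rw [M.proj_proj hA hB, Set.inter_eq_right.2 h]

theorem proj_idem {A : Set X} (hA : A ∈ 𝒳.meas) (v : H) :
    M.proj A (M.proj A v) = M.proj A v :=
  M.proj_proj_of_subset hA hA subset_rfl v

theorem adjoint_proj {A : Set X} (hA : A ∈ 𝒳.meas) :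
    ContinuousLinearMap.adjoint (M.proj A) = M.proj A := by
  rw [← ContinuousLinearMap.star_eq_adjoint]
  exact M.proj_selfAdjoint A hA

theorem inner_proj {A : Set X} (hA : A ∈ 𝒳.meas) (v w : H) :
    inner ℂ (M.proj A v) w = inner ℂ v (M.proj A w) := by
  rw [← ContinuousLinearMap.adjoint_inner_left, M.adjoint_proj hA]

theorem inner_proj_self {A : Set X} (hA : A ∈ 𝒳.meas) (v : H) :
    inner ℂ v (M.proj A v) = ((‖M.proj A v‖ ^ 2 : ℝ) : ℂ) := by
  rw [← M.proj_idem hA, ← M.inner_proj hA, inner_self_eq_norm_sq_to_K, M.proj_idem hA]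
  simp

theorem norm_proj_le {A : Set X} (hA : A ∈ 𝒳.meas) (v : H) : ‖M.proj A v‖ ≤ ‖v‖ := by
  have h1 : ‖M.proj A v‖ ^ 2 ≤ ‖v‖ * ‖M.proj A v‖ := by
    have := norm_inner_le_norm (𝕜 := ℂ) v (M.proj A v)
    rw [M.inner_proj_self hA] at this
    simpa [abs_of_nonneg] using this
  rcases (norm_nonneg (M.proj A v)).eq_or_lt with h | h
  · rw [← h]; exact norm_nonneg v
  · nlinarith

theorem inner_eq_zero_of_disjoint {A B : Set X} (hA : A ∈ 𝒳.meas) (hB : B ∈ 𝒳.meas)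
    (hAB : Disjoint A B) {v w : H} (hv : M.proj A v = v) (hw : M.proj B w = w) :
    inner ℂ v w = 0 := by
  rw [← hv, ← hw, M.inner_proj hA, M.proj_proj hA hB, hAB.inter_eq, M.proj_empty]
  simp

theorem proj_biUnion {ι : Type} (I : Finset ι) {W : ι → Set X} (hW : ∀ i ∈ I, W i ∈ 𝒳.meas)
    (hd : ∀ i ∈ I, ∀ j ∈ I, i ≠ j → Disjoint (W i) (W j)) :
    M.proj (⋃ i ∈ I, W i) = ∑ i ∈ I, M.proj (W i) := by
  classical
  induction I using Finset.induction_on with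
  | empty => simpa using M.proj_empty
  | insert a s ha ih =>
    rw [Finset.set_biUnion_insert, Finset.sum_insert ha, M.proj_union (hW a (by simp))
      (𝒳.biUnion_mem s fun i hi => hW i (by simp [hi])), ih (fun i hi => hW i (by simp [hi]))
      (fun i hi j hj => hd i (by simp [hi]) j (by simp [hj]))]
    rw [Set.disjoint_iUnion₂_right]
    exact fun i hi => hd a (by simp) i (by simp [hi]) (by rintro rfl; exact ha hi)

theorem sum_norm_sq_proj {ι : Type} (I : Finset ι) {W : ι → Set X}
    (hW : ∀ i ∈ I, W i ∈ 𝒳.meas)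
    (hd : ∀ i ∈ I, ∀ j ∈ I, i ≠ j → Disjoint (W i) (W j)) (v : H) :
    ∑ i ∈ I, ‖M.proj (W i) v‖ ^ 2 = ‖M.proj (⋃ i ∈ I, W i) v‖ ^ 2 := by
  have h := M.inner_proj_self (𝒳.biUnion_mem I hW) v
  rw [M.proj_biUnion I hW hd, sum_apply, inner_sum,
    Finset.sum_congr rfl fun i hi => M.inner_proj_self (hW i hi) v] at h
  rw [M.proj_biUnion I hW hd, sum_apply]
  exact_mod_cast h

/-- Every vector is approximated by its components in finitely many blocks. -/
theorem exists_finset_blocks (v : H) {ε : ℝ} (hε : 0 < ε) :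
    ∃ I : Finset (Set X), (∀ A ∈ I, A ∈ 𝒳.partition) ∧
      ‖v - M.proj (⋃ A ∈ I, A) v‖ < ε := by
  classical
  have hm : ∀ I : Finset (Set X), (∀ A ∈ I, A ∈ 𝒳.partition) → (⋃ A ∈ I, A) ∈ 𝒳.meas :=
    fun I hI => 𝒳.biUnion_mem I fun A hA => 𝒳.isPartition.measurable (hI A hA)
  obtain ⟨y, hy, hvy⟩ := Metric.mem_closure_iff.1 (M.nondeg v) (ε / 2) (half_pos hε)
  obtain ⟨I, hI, hIy⟩ : ∃ I : Finset (Set X), (∀ A ∈ I, A ∈ 𝒳.partition) ∧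
      M.proj (⋃ A ∈ I, A) y = y := by
    clear hvy
    induction hy using Submodule.span_induction with
    | mem z hz =>
      simp only [Set.mem_iUnion, Set.mem_range] at hz
      obtain ⟨A, ⟨hA, hAb⟩, w, rfl⟩ := hz
      have hfin := 𝒳.isPartition.locallyFinite A hAb
      refine ⟨hfin.toFinset, fun B hB => (hfin.mem_toFinset.1 hB).1, ?_⟩
      refine M.proj_proj_of_superset (hm _ fun B hB => (hfin.mem_toFinset.1 hB).1) hA ?_ w
      intro x hx
      obtain ⟨B, hB, hxB⟩ := 𝒳.exists_block x
      exact Set.mem_biUnion (hfin.mem_toFinset.2 ⟨hB, x, hxB, hx⟩) hxB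
    | zero => exact ⟨∅, by simp, by simp⟩
    | add a b _ _ ha hb =>
      obtain ⟨I, hI, hIa⟩ := ha
      obtain ⟨J, hJ, hJb⟩ := hb
      have hU : ∀ A ∈ I ∪ J, A ∈ 𝒳.partition := fun A hA =>
        (Finset.mem_union.1 hA).elim (hI A) (hJ A)
      refine ⟨I ∪ J, hU, ?_⟩
      rw [map_add]
      congr 1
      · rw [← hIa, M.proj_proj_of_superset (hm _ hU) (hm _ hI)]
        exact Set.biUnion_subset_biUnion_left fun A hA => Finset.mem_union_left _ hA
      · rw [← hJb, M.proj_proj_of_superset (hm _ hU) (hm _ hJ)]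
        exact Set.biUnion_subset_biUnion_left fun A hA => Finset.mem_union_right _ hA
    | smul c a _ ha =>
      obtain ⟨I, hI, hIa⟩ := ha
      exact ⟨I, hI, by rw [map_smul, hIa]⟩
  refine ⟨I, hI, ?_⟩
  rw [dist_eq_norm] at hvy
  have h1 : v - M.proj (⋃ A ∈ I, A) v = (v - y) - M.proj (⋃ A ∈ I, A) (v - y) := by
    rw [map_sub, hIy]; abel
  have h2 := M.norm_proj_le (hm I hI) (v - y)
  rw [h1]
  linarith [norm_sub_le (v - y) (M.proj (⋃ A ∈ I, A) (v - y))]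

theorem disjoint_blocks {I : Finset (Set X)} (hI : ∀ A ∈ I, A ∈ 𝒳.partition) :
    ∀ A ∈ I, ∀ B ∈ I, A ≠ B → Disjoint A B :=
  fun A hA B hB => 𝒳.isPartition.pairwiseDisjoint A (hI A hA) B (hI B hB)

/-- An operator vanishing on all block components of a vector vanishes on the vector. -/
theorem map_eq_zero_of_forall_block {K : Type} [NormedAddCommGroup K] [InnerProductSpace ℂ K]
    {t : H →L[ℂ] K} {v : H} (h : ∀ A ∈ 𝒳.partition, t (M.proj A v) = 0) : t v = 0 := by
  by_contra hv
  have ht : 0 < ‖t‖ + 1 := by positivity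
  obtain ⟨I, hI, hlt⟩ := M.exists_finset_blocks v (div_pos (norm_pos_iff.2 hv) ht)
  have h0 : t (M.proj (⋃ A ∈ I, A) v) = 0 := by
    rw [M.proj_biUnion I (W := fun A => A) (fun A hA => 𝒳.isPartition.measurable (hI A hA))
      (disjoint_blocks hI), sum_apply, map_sum]
    exact Finset.sum_eq_zero fun A hA => h A (hI A hA)
  have h1 : ‖t v‖ ≤ ‖t‖ * ‖v - M.proj (⋃ A ∈ I, A) v‖ := by
    simpa [map_sub, h0] using t.le_opNorm (v - M.proj (⋃ A ∈ I, A) v)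
  rw [lt_div_iff₀ ht] at hlt
  nlinarith [norm_nonneg (v - M.proj (⋃ A ∈ I, A) v), norm_nonneg t]

/-- The `1`-domain is the union of the disc-bounded sets with nonzero projection. -/
theorem mem_domKappa_one {x : X} :
    x ∈ domKappa 𝒳 M 1 ↔ ∃ A, 𝒳.IsDiscBounded A ∧ M.proj A ≠ 0 ∧ x ∈ A := by
  have hr : ∀ p : H →L[ℂ] H, 1 ≤ projRank p ↔ p ≠ 0 := by
    intro p
    rw [Cardinal.one_le_iff_ne_zero, projRank, LinearMap.rank, Ne, Submodule.rank_eq_zero,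
      LinearMap.range_eq_bot]
    exact not_congr ⟨fun h => by ext v; exact congrArg (· v) h, fun h => by rw [h]; rfl⟩
  simp only [domKappa, domKappaAt, Set.mem_sUnion, Set.mem_ofPred_eq, hr]
  exact ⟨fun ⟨A, ⟨h1, h2, h3⟩, h4⟩ => ⟨A, ⟨h1, h2⟩, h3, h4⟩,
    fun ⟨A, ⟨h1, h2⟩, h3, h4⟩ => ⟨A, ⟨h1, h2, h3⟩, h4⟩⟩

theorem exists_unit_of_proj_ne_zero {A : Set X} (hA : A ∈ 𝒳.meas) (h : M.proj A ≠ 0) :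
    ∃ v, ‖v‖ = 1 ∧ M.proj A v = v := by
  obtain ⟨w, hw⟩ : ∃ w, M.proj A w ≠ 0 := by
    by_contra! hc
    exact h (by ext w; simpa using hc w)
  refine ⟨((‖M.proj A w‖⁻¹ : ℝ) : ℂ) • M.proj A w, ?_, ?_⟩
  · rw [norm_smul]
    simp [hw]
  · rw [map_smul, M.proj_idem hA]

theorem isFaithfulMod_iff :
    IsFaithfulMod 𝒳 M ↔ 𝒳.coarse.Subordinate Set.univ (domKappa 𝒳 M 1) :=
  ⟨fun h => h.2, fun h => ⟨⟨_, 𝒳.coarse.diagonal_mem, fun x _ => ⟨x, trivial, rfl⟩⟩, h⟩⟩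

end CoarseModule

/-! ## Approximable operators -/

section Approximable

variable {X : Type} {𝒳 : LFCMSpace X} {H K L : Type}
  [NormedAddCommGroup H] [InnerProductSpace ℂ H] [CompleteSpace H]
  [NormedAddCommGroup K] [InnerProductSpace ℂ K] [CompleteSpace K]
  [NormedAddCommGroup L] [InnerProductSpace ℂ L] [CompleteSpace L]
  {M : CoarseModule 𝒳 H} {N : CoarseModule 𝒳 K} {P : CoarseModule 𝒳 L}

theorem prod_subset_opSupp {t : H →L[ℂ] K} {A B : Set X} (hB : 𝒳.IsDiscBounded B)
    (hA : 𝒳.IsDiscBounded A) {v : H} (h : N.proj B (t (M.proj A v)) ≠ 0) :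
    B ×ˢ A ⊆ opSupp 𝒳 𝒳 M.proj N.proj t :=
  Set.subset_sUnion_of_mem ⟨B, A, rfl, hB.1, hB.2, hA.1, hA.2, fun h0 => h (congrArg (· v) h0)⟩

theorem hasControlledPropagation_of_forall {E : Set (X × X)} (hE : E ∈ 𝒳.coarse.entourages)
    {t : H →L[ℂ] K}
    (h : ∀ B A v, 𝒳.IsDiscBounded B → 𝒳.IsDiscBounded A → N.proj B (t (M.proj A v)) ≠ 0 →
      B ×ˢ A ⊆ E) : HasControlledPropagation 𝒳 M.proj N.proj t := by
  refine 𝒳.coarse.mem_of_subset hE (Set.sUnion_subset ?_)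
  rintro _ ⟨B, A, rfl, hB, hB', hA, hA', hne⟩
  obtain ⟨v, hv⟩ : ∃ v, N.proj B (t (M.proj A v)) ≠ 0 := by
    by_contra! hc
    exact hne (by ext v; simpa using hc v)
  exact h B A v ⟨hB, hB'⟩ ⟨hA, hA'⟩ hv

theorem HasControlledPropagation.approximable {t : H →L[ℂ] K}
    (h : HasControlledPropagation 𝒳 M.proj N.proj t) : Approximable 𝒳 M.proj N.proj t :=
  fun ε hε => ⟨t, h, by simpa using hε.le⟩

theorem HasControlledPropagation.comp {s : K →L[ℂ] L} {t : H →L[ℂ] K}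
    (hs : HasControlledPropagation 𝒳 N.proj P.proj s)
    (ht : HasControlledPropagation 𝒳 M.proj N.proj t) :
    HasControlledPropagation 𝒳 M.proj P.proj (s ∘L t) := by
  refine hasControlledPropagation_of_forall (𝒳.coarse.comp_mem hs ht) fun B A v hB hA hne => ?_
  obtain ⟨D, hD, hDne⟩ : ∃ D ∈ 𝒳.partition, P.proj B (s (N.proj D (t (M.proj A v)))) ≠ 0 := by
    by_contra! hc
    exact hne (N.map_eq_zero_of_forall_block (t := P.proj B ∘L s) hc)
  have hD' := 𝒳.isDiscBounded_of_mem_partition hD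
  obtain ⟨d, hd⟩ := 𝒳.isPartition.nonempty D hD
  have h1 := prod_subset_opSupp (M := N) (N := P) hB hD' hDne
  have h2 : D ×ˢ A ⊆ opSupp 𝒳 𝒳 M.proj N.proj t :=
    prod_subset_opSupp (v := v) hD' hA fun h0 => hDne (by simp [h0])
  exact fun p hp => ⟨d, h1 ⟨hp.1, hd⟩, h2 ⟨hd, hp.2⟩⟩

theorem HasControlledPropagation.adjoint {t : H →L[ℂ] K}
    (ht : HasControlledPropagation 𝒳 M.proj N.proj t) :
    HasControlledPropagation 𝒳 N.proj M.proj (ContinuousLinearMap.adjoint t) := by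
  refine hasControlledPropagation_of_forall (𝒳.coarse.transpose_mem ht)
    fun B A v hB hA hne => ?_
  obtain ⟨w, hw⟩ : ∃ w, N.proj A (t (M.proj B w)) ≠ 0 := by
    by_contra! hc
    refine hne (ext_inner_left ℂ fun w => ?_)
    rw [← M.inner_proj hB.1, ContinuousLinearMap.adjoint_inner_right, ← N.inner_proj hA.1, hc,
      inner_zero_left, inner_zero_right]
  have := prod_subset_opSupp (M := M) (N := N) hA hB hw
  exact fun p hp => this ⟨hp.2, hp.1⟩

theorem Approximable.adjoint {t : H →L[ℂ] K} (ht : Approximable 𝒳 M.proj N.proj t) :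
    Approximable 𝒳 N.proj M.proj (ContinuousLinearMap.adjoint t) := by
  intro ε hε
  obtain ⟨s, hs, hts⟩ := ht ε hε
  refine ⟨_, hs.adjoint, ?_⟩
  rwa [← map_sub, LinearIsometryEquiv.norm_map]

theorem Approximable.comp {s : K →L[ℂ] L} {t : H →L[ℂ] K}
    (hs : Approximable 𝒳 N.proj P.proj s) (ht : Approximable 𝒳 M.proj N.proj t) :
    Approximable 𝒳 M.proj P.proj (s ∘L t) := by
  intro ε hε
  have ha : 0 < ‖s‖ + ‖t‖ + 1 := by positivity
  set η := min 1 (ε / (‖s‖ + ‖t‖ + 1)) with hη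
  have hη0 : 0 < η := lt_min one_pos (div_pos hε ha)
  obtain ⟨s', hs', hss⟩ := hs η hη0
  obtain ⟨t', ht', htt⟩ := ht η hη0
  refine ⟨_, hs'.comp ht', ?_⟩
  have h1 : s ∘L t - s' ∘L t' = (s - s') ∘L t' + s ∘L (t - t') := by
    ext v; simp
  have h2 : ‖t'‖ ≤ ‖t‖ + 1 := by
    have := norm_sub_le t (t - t')
    rw [sub_sub_cancel] at this
    linarith [min_le_left 1 (ε / (‖s‖ + ‖t‖ + 1))]
  have h3 : η * (‖s‖ + ‖t‖ + 1) ≤ ε := by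
    rw [← le_div_iff₀ ha]; exact min_le_right _ _
  calc ‖s ∘L t - s' ∘L t'‖ ≤ ‖s - s'‖ * ‖t'‖ + ‖s‖ * ‖t - t'‖ := by
        rw [h1]
        exact (norm_add_le _ _).trans (add_le_add (ContinuousLinearMap.opNorm_comp_le _ _)
          (ContinuousLinearMap.opNorm_comp_le _ _))
    _ ≤ η * (‖t‖ + 1) + ‖s‖ * η := by gcongr
    _ ≤ ε := by linarith

theorem Approximable.smul {t : H →L[ℂ] K} (c : ℂ) (ht : Approximable 𝒳 M.proj N.proj t) :
    Approximable 𝒳 M.proj N.proj (c • t) := by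
  intro ε hε
  have ha : 0 < ‖c‖ + 1 := by positivity
  obtain ⟨s, hs, hts⟩ := ht (ε / (‖c‖ + 1)) (div_pos hε ha)
  refine ⟨c • s, hasControlledPropagation_of_forall hs fun B A v hB hA hne => ?_, ?_⟩
  · refine prod_subset_opSupp (v := v) hB hA fun h0 => hne ?_
    simp [h0]
  · rw [← smul_sub, norm_smul]
    rw [le_div_iff₀ ha] at hts
    nlinarith [norm_nonneg c, norm_nonneg (t - s)]

/-- A sum of rank-one operators `u j ⊗ (c j)^*`, with `c j` and `u j` supported in
uniformly close sets, is approximable. -/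
theorem approximable_of_hasSum {J : Type} {E : Set (X × X)} (hE : E ∈ 𝒳.coarse.entourages)
    {c : J → H} {u : J → K} {b W : J → Set X} (hb : ∀ j, b j ∈ 𝒳.meas)
    (hW : ∀ j, W j ∈ 𝒳.meas) (hc : ∀ j, M.proj (b j) (c j) = c j)
    (hu : ∀ j, N.proj (W j) (u j) = u j) (hWb : ∀ j, W j ×ˢ b j ⊆ E) {s : H →L[ℂ] K}
    (hs : ∀ x, HasSum (fun j => inner ℂ (c j) x • u j) (s x)) :
    Approximable 𝒳 M.proj N.proj s := by
  refine (hasControlledPropagation_of_forall (𝒳.disc_comp_mem hE)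
    fun B A v hB hA hne => ?_).approximable
  obtain ⟨j, hj⟩ : ∃ j, inner ℂ (c j) (M.proj A v) • N.proj B (u j) ≠ 0 := by
    by_contra! hc
    have := (N.proj B).hasSum (hs (M.proj A v))
    simp only [map_smul, hc] at this
    exact hne (this.unique hasSum_zero)
  obtain ⟨h1, h2⟩ := smul_ne_zero_iff.1 hj
  obtain ⟨y, hyB, hyW⟩ : (B ∩ W j).Nonempty := by
    rw [Set.nonempty_iff_ne_empty]
    intro h0
    rw [← hu j, N.proj_proj hB.1 (hW j), h0, N.proj_empty] at h2
    exact h2 rfl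
  obtain ⟨x, hxA, hxb⟩ : (A ∩ b j).Nonempty := by
    rw [Set.nonempty_iff_ne_empty]
    intro h0
    rw [← M.inner_proj hA.1, ← hc j, M.proj_proj hA.1 (hb j), h0, M.proj_empty] at h1
    exact h1 (by simp)
  exact 𝒳.prod_subset_disc_comp hB hA hyB hxA (hWb j ⟨hyW, hxb⟩)

theorem approximable_rankOne {E : Set (X × X)} (hE : E ∈ 𝒳.coarse.entourages)
    {c : H} {u : K} {b W : Set X} (hb : b ∈ 𝒳.meas) (hW : W ∈ 𝒳.meas)
    (hc : M.proj b c = c) (hu : N.proj W u = u) (hWb : W ×ˢ b ⊆ E) :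
    Approximable 𝒳 M.proj N.proj (rankOne ℂ u c) :=
  approximable_of_hasSum (J := Unit) (c := fun _ => c) (u := fun _ => u) hE (fun _ => hb)
    (fun _ => hW) (fun _ => hc) (fun _ => hu) (fun _ => hWb) fun x => by
      simp

/-- Compressions to bounded sets are approximable. -/
theorem approximable_compression {W : Set X} (hW : W ∈ 𝒳.meas) (hWb : 𝒳.coarse.IsBounded W)
    (t : H →L[ℂ] H) : Approximable 𝒳 M.proj M.proj (M.proj W ∘L t ∘L M.proj W) := by
  obtain ⟨E, hE, hWE⟩ := hWb
  refine (hasControlledPropagation_of_forall (𝒳.disc_comp_mem hE)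
    fun B A v hB hA hne => ?_).approximable
  simp only [ContinuousLinearMap.comp_apply] at hne
  obtain ⟨y, hyB, hyW⟩ : (B ∩ W).Nonempty := by
    rw [Set.nonempty_iff_ne_empty]
    intro h0
    rw [M.proj_proj hB.1 hW, h0, M.proj_empty] at hne
    exact hne rfl
  obtain ⟨x, hxW, hxA⟩ : (W ∩ A).Nonempty := by
    rw [Set.nonempty_iff_ne_empty]
    intro h0
    rw [M.proj_proj hW hA.1 , h0, M.proj_empty] at hne
    exact hne (by simp)
  exact 𝒳.prod_subset_disc_comp hB hA hyB hxA (hWE ⟨hyW, hxW⟩)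

end Approximable

/-! ## Operators built from orthonormal families -/

/-- The partial isometry sending one orthonormal family to another. -/
theorem exists_hasSum_of_orthonormal {J H K : Type} [NormedAddCommGroup H]
    [InnerProductSpace ℂ H] [CompleteSpace H] [NormedAddCommGroup K] [InnerProductSpace ℂ K]
    [CompleteSpace K] {c : J → H} {u : J → K} (hc : Orthonormal ℂ c) (hu : Orthonormal ℂ u) :
    ∃ s : H →L[ℂ] K, ∀ x, HasSum (fun j => inner ℂ (c j) x • u j) (s x) := by
  classical
  let V := hc.orthogonalFamily.linearIsometry.toContinuousLinearMap
  let U := hu.orthogonalFamily.linearIsometry.toContinuousLinearMap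
  refine ⟨U ∘L ContinuousLinearMap.adjoint V, fun x => ?_⟩
  have h := hu.orthogonalFamily.hasSum_linearIsometry (ContinuousLinearMap.adjoint V x)
  convert h using 2 with j
  swap
  · rfl
  rw [LinearIsometry.toSpanSingleton_apply]
  congr 1
  have h1 := lp.inner_single_left (𝕜 := ℂ) j (1 : ℂ) (ContinuousLinearMap.adjoint V x)
  rw [ContinuousLinearMap.adjoint_inner_right] at h1
  have h2 : V (lp.single 2 j (1 : ℂ)) = c j := by
    have := hc.orthogonalFamily.linearIsometry_apply_single (i := j) (1 : ℂ)
    rw [LinearIsometry.toSpanSingleton_apply, one_smul] at this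
    exact this
  rw [h2] at h1
  simpa using h1

/-- Bessel's inequality for the adjoint of an operator sending `c j` to `u j`. -/
theorem sum_norm_inner_sq_le_norm_adjoint_sq {J H K : Type} [NormedAddCommGroup H]
    [InnerProductSpace ℂ H] [CompleteSpace H] [NormedAddCommGroup K] [InnerProductSpace ℂ K]
    [CompleteSpace K] {c : J → H} {u : J → K} (hc : Orthonormal ℂ c) {s : H →L[ℂ] K}
    (hs : ∀ x, HasSum (fun j => inner ℂ (c j) x • u j) (s x)) (y : K) (I : Finset J) :
    ∑ j ∈ I, ‖inner ℂ (u j) y‖ ^ 2 ≤ ‖ContinuousLinearMap.adjoint s y‖ ^ 2 := by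
  classical
  have h : ∀ j, s (c j) = u j := by
    intro j
    refine (hs (c j)).unique ?_
    convert hasSum_ite_eq j (u j) using 2 with i
    rw [orthonormal_iff_ite.1 hc i j]
    split_ifs with hij
    · rw [one_smul, hij]
    · rw [zero_smul]
  refine le_trans (le_of_eq ?_)
    (hc.sum_inner_products_le (s := I) (ContinuousLinearMap.adjoint s y))
  refine Finset.sum_congr rfl fun j _ => ?_
  rw [ContinuousLinearMap.adjoint_inner_right, h]

/-! ## Functors between approximable categories -/

section Functor

theorem approximable_id {X : Type} {𝒳 : LFCMSpace X} {H : Type} [NormedAddCommGroup H]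
    [InnerProductSpace ℂ H] [CompleteSpace H] {M : CoarseModule 𝒳 H} :
    Approximable 𝒳 M.proj M.proj (ContinuousLinearMap.id ℂ H) := by
  refine (hasControlledPropagation_of_forall (𝒳.disc_comp_mem 𝒳.disc_mem)
    fun B A v hB hA hne => ?_).approximable
  rw [ContinuousLinearMap.id_apply, M.proj_proj hB.1 hA.1] at hne
  obtain ⟨y, hyB, hyA⟩ : (B ∩ A).Nonempty := by
    rw [Set.nonempty_iff_ne_empty]
    intro h0
    rw [h0, M.proj_empty] at hne
    exact hne rfl
  exact 𝒳.prod_subset_disc_comp hB hA hyB hyA (𝒳.disc_refl y)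

/-- Faithfulness passes along approximable operators with a bounded left inverse. -/
theorem IsFaithfulMod.of_leftInverse {X : Type} {𝒳 : LFCMSpace X} {H K : Type}
    [NormedAddCommGroup H] [InnerProductSpace ℂ H] [CompleteSpace H]
    [NormedAddCommGroup K] [InnerProductSpace ℂ K] [CompleteSpace K]
    {M : CoarseModule 𝒳 H} {N : CoarseModule 𝒳 K} (hM : IsFaithfulMod 𝒳 M) {v : H →L[ℂ] K}
    (hv : Approximable 𝒳 M.proj N.proj v) {u : K →L[ℂ] H}
    (huv : u ∘L v = ContinuousLinearMap.id ℂ H) : IsFaithfulMod 𝒳 N := by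
  obtain ⟨E, hE, hdom⟩ := M.isFaithfulMod_iff.1 hM
  have hu : 0 < ‖u‖ + 1 := by positivity
  obtain ⟨v', hv', hvv⟩ := hv (‖u‖ + 1)⁻¹ (inv_pos.2 hu)
  refine N.isFaithfulMod_iff.2 ⟨_, 𝒳.coarse.comp_mem hE (𝒳.coarse.transpose_mem hv'), ?_⟩
  intro x _
  obtain ⟨y, hy, hxy⟩ := hdom (Set.mem_univ x)
  obtain ⟨b, hb, hbne, hyb⟩ := M.mem_domKappa_one.1 hy
  obtain ⟨ξ, hξ, hbξ⟩ := M.exists_unit_of_proj_ne_zero hb.1 hbne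
  have hne : v' ξ ≠ 0 := by
    intro h0
    have h1 : u ((v - v') ξ) = ξ := by
      rw [sub_apply, h0, sub_zero]
      exact congrArg (· ξ) huv
    have h2 := u.le_opNorm ((v - v') ξ)
    have h3 := (v - v').le_opNorm ξ
    rw [h1, hξ] at h2
    rw [hξ, mul_one] at h3
    have h4 := h3.trans hvv
    rw [inv_eq_one_div, le_div_iff₀ hu] at h4
    nlinarith [norm_nonneg u, norm_nonneg ((v - v') ξ)]
  obtain ⟨a, ha, hane⟩ : ∃ a ∈ 𝒳.partition, N.proj a (v' ξ) ≠ 0 := by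
    by_contra! hc
    exact hne (N.map_eq_zero_of_forall_block (t := ContinuousLinearMap.id ℂ K) hc)
  obtain ⟨z, hz⟩ := 𝒳.isPartition.nonempty a ha
  have ha' := 𝒳.isDiscBounded_of_mem_partition ha
  refine ⟨z, N.mem_domKappa_one.2 ⟨a, ha', fun h0 => hane (by rw [h0]; rfl), hz⟩, y, hxy, ?_⟩
  exact prod_subset_opSupp (v := ξ) ha' hb (by rwa [hbξ]) ⟨hz, hyb⟩

variable {X Y : Type} {𝒳 : LFCMSpace X} {𝒴 : LFCMSpace Y}

namespace StarFunctor

variable (F : StarFunctor 𝒳 𝒴)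

theorem map_congr {C D : BundledModule 𝒳} {t t' : C.H →L[ℂ] D.H} (h : t = t')
    (ht : Approximable 𝒳 C.mod.proj D.mod.proj t)
    (ht' : Approximable 𝒳 C.mod.proj D.mod.proj t') : F.map t ht = F.map t' ht' := by
  subst h; rfl

theorem map_eq_zero {C D : BundledModule 𝒳} {t : C.H →L[ℂ] D.H} (h : t = 0)
    (ht : Approximable 𝒳 C.mod.proj D.mod.proj t) : F.map t ht = 0 := by
  have h0 := F.map_smul 0 t ht (ht.smul 0)
  refine (F.map_congr (by rw [h, smul_zero]) ht (ht.smul 0)).trans (h0.trans ?_)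
  rw [zero_smul]

variable {F}

/-- A full and faithful *-functor reflects rank-one projections. -/
theorem exists_rankOne_preimage (hfull : F.Full) (hF : F.Faithful) {D : BundledModule 𝒳}
    {w : (F.obj D).H} (hw : ‖w‖ = 1)
    (hwa : Approximable 𝒴 (F.obj D).mod.proj (F.obj D).mod.proj (rankOne ℂ w w)) :
    ∃ v : D.H, ‖v‖ = 1 ∧ ∃ hv : Approximable 𝒳 D.mod.proj D.mod.proj (rankOne ℂ v v),
      F.map (rankOne ℂ v v) hv = rankOne ℂ w w := by
  obtain ⟨p, hp, hFp⟩ := hfull D D _ hwa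
  have hww : rankOne ℂ w w w = w := by simp [hw]
  have hpa : ContinuousLinearMap.adjoint p = p :=
    hF _ _ _ _ hp.adjoint hp (by rw [F.map_star _ hp, hFp, adjoint_rankOne])
  have hpp : p ∘L p = p :=
    hF _ _ _ _ (hp.comp hp) hp (by
      rw [F.map_comp _ _ hp hp, hFp, rankOne_comp_rankOne]
      simp [hw])
  obtain ⟨A, hA, x, hx⟩ : ∃ A ∈ 𝒳.partition, ∃ x, p (D.mod.proj A x) ≠ 0 := by
    by_contra! hc
    have hp0 : p = 0 := by
      ext x
      exact D.mod.map_eq_zero_of_forall_block fun A hA => hc A hA x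
    rw [F.map_eq_zero hp0] at hFp
    rw [← hFp] at hww
    rw [← hww] at hw
    simp at hw
  have hA' := 𝒳.isPartition.measurable hA
  set ξ := D.mod.proj A x with hξ
  have hT : Approximable 𝒳 D.mod.proj D.mod.proj (rankOne ℂ ξ ξ) :=
    approximable_rankOne 𝒳.disc_mem hA' hA' (D.mod.proj_idem hA' x) (D.mod.proj_idem hA' x)
      (𝒳.isDiscBounded_of_mem_partition hA).2
  have hpTp : p ∘L rankOne ℂ ξ ξ ∘L p = rankOne ℂ (p ξ) (p ξ) := by
    rw [rankOne_comp, comp_rankOne, hpa]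
  obtain ⟨c, hc⟩ : ∃ c : ℂ, rankOne ℂ (p ξ) (p ξ) = c • p := by
    refine ⟨inner ℂ w (F.map _ hT w), ?_⟩
    rw [← hpTp]
    refine hF _ _ _ _ (hp.comp (hT.comp hp)) (hp.smul _) ?_
    rw [F.map_comp _ _ (hT.comp hp) hp, F.map_comp _ _ hp hT, F.map_smul _ _ hp, hFp,
      comp_rankOne, rankOne_comp_rankOne]
  have hη : 0 < ‖p ξ‖ := norm_pos_iff.2 hx
  have hc' : c = ((‖p ξ‖ ^ 2 : ℝ) : ℂ) := by
    have h1 := congrArg (· (p ξ)) hc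
    have h2 : p (p ξ) = p ξ := congrArg (· ξ) hpp
    simp only [rankOne_apply, smul_apply, h2] at h1
    rw [inner_self_eq_norm_sq_to_K] at h1
    rw [← smul_left_injective ℂ hx h1]
    simp
  have hvp : rankOne ℂ (((‖p ξ‖⁻¹ : ℝ) : ℂ) • p ξ) (((‖p ξ‖⁻¹ : ℝ) : ℂ) • p ξ) = p := by
    have h1 : (‖p ξ‖ : ℂ) ≠ 0 := by exact_mod_cast hη.ne'
    have h2 : rankOne ℂ (((‖p ξ‖⁻¹ : ℝ) : ℂ) • p ξ) (((‖p ξ‖⁻¹ : ℝ) : ℂ) • p ξ) =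
        (((‖p ξ‖⁻¹ : ℝ) : ℂ) * ((‖p ξ‖⁻¹ : ℝ) : ℂ)) • rankOne ℂ (p ξ) (p ξ) := by
      ext y
      simp only [rankOne_apply, smul_apply, inner_smul_left, smul_smul, Complex.conj_ofReal]
      ring_nf
    rw [h2, hc, hc', smul_smul]
    push_cast
    rw [show (‖p ξ‖ : ℂ)⁻¹ * (‖p ξ‖ : ℂ)⁻¹ * (‖p ξ‖ : ℂ) ^ 2 = 1 by field_simp, one_smul]
  refine ⟨((‖p ξ‖⁻¹ : ℝ) : ℂ) • p ξ, ?_, by rw [hvp]; exact hp, ?_⟩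
  · rw [norm_smul]
    simp [hη.ne']
  · rw [← hFp]
    exact F.map_congr hvp _ _

/-- Functors preserve the norm `‖s^* v‖` along corresponding rank-one projections. -/
theorem norm_adjoint_eq {C D : BundledModule 𝒳} {v : D.H} {w : (F.obj D).H} (hw : ‖w‖ = 1)
    {hv : Approximable 𝒳 D.mod.proj D.mod.proj (rankOne ℂ v v)}
    (hvw : F.map (rankOne ℂ v v) hv = rankOne ℂ w w) {s : C.H →L[ℂ] D.H}
    (hs : Approximable 𝒳 C.mod.proj D.mod.proj s) :
    ‖ContinuousLinearMap.adjoint s v‖ = ‖ContinuousLinearMap.adjoint (F.map s hs) w‖ := by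
  have key : ∀ {H K : Type} [NormedAddCommGroup H] [InnerProductSpace ℂ H] [CompleteSpace H]
      [NormedAddCommGroup K] [InnerProductSpace ℂ K] [CompleteSpace K] (t : H →L[ℂ] K) (y : K),
      (rankOne ℂ y y ∘L t) ∘L ContinuousLinearMap.adjoint (rankOne ℂ y y ∘L t) =
        ((‖ContinuousLinearMap.adjoint t y‖ ^ 2 : ℝ) : ℂ) • rankOne ℂ y y := by
    intro H K _ _ _ _ _ _ t y
    rw [rankOne_comp, adjoint_rankOne, rankOne_comp_rankOne, inner_self_eq_norm_sq_to_K]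
    simp
  have hr := hv.comp hs
  have h1 := key (F.map s hs) w
  have h2 : F.map _ hr = rankOne ℂ w w ∘L F.map s hs := by rw [F.map_comp _ _ hs hv, hvw]
  rw [← h2, ← F.map_star _ hr hr.adjoint, ← F.map_comp _ _ hr.adjoint hr (hr.comp hr.adjoint),
    F.map_congr (key s v) _ (hv.smul _), F.map_smul _ _ hv, hvw] at h1
  have h3 := congrArg (fun t => ‖t w‖) h1
  simp only [smul_apply, rankOne_apply, norm_smul, hw] at h3
  have hwn : ‖(inner ℂ w w : ℂ)‖ = 1 := by simp [inner_self_eq_norm_sq_to_K, hw]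
  rw [hwn] at h3
  simp only [mul_one, Complex.norm_real, norm_pow, norm_norm] at h3
  exact (pow_left_inj₀ (norm_nonneg _) (norm_nonneg _) two_ne_zero).1 h3

theorem norm_inner_eq {D : BundledModule 𝒳} {v v' : D.H} {w w' : (F.obj D).H}
    (hw : ‖w‖ = 1) {hv : Approximable 𝒳 D.mod.proj D.mod.proj (rankOne ℂ v v)}
    (hvw : F.map (rankOne ℂ v v) hv = rankOne ℂ w w) (hv1 : ‖v'‖ = 1) (hw1 : ‖w'‖ = 1)
    {hv' : Approximable 𝒳 D.mod.proj D.mod.proj (rankOne ℂ v' v')}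
    (hvw' : F.map (rankOne ℂ v' v') hv' = rankOne ℂ w' w') {t : D.H →L[ℂ] D.H}
    (ht : Approximable 𝒳 D.mod.proj D.mod.proj t) :
    ‖inner ℂ v (t v')‖ = ‖inner ℂ w (F.map t ht w')‖ := by
  have h := norm_adjoint_eq hw hvw (ht.comp hv')
  rw [F.map_comp _ _ hv' ht, hvw', comp_rankOne, comp_rankOne, adjoint_rankOne, adjoint_rankOne,
    rankOne_apply, rankOne_apply, norm_smul, norm_smul, hv1, hw1, mul_one, mul_one,
    norm_inner_symm, norm_inner_symm _ w] at h
  exact h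

end StarFunctor

end Functor

/-! ## Gliding humps -/

/-- Finite sets carrying a fixed mass of a pointwise null sequence can be made disjoint. -/
theorem exists_disjoint_humps {ι : Type} {f : ι → ℕ → ℝ} (hf : ∀ b n, 0 ≤ f b n)
    (h0 : ∀ b, Tendsto (f b) atTop (𝓝 0)) {c : ℝ} (hc : 0 < c)
    (hI : ∀ n, ∃ I : Finset ι, c ≤ ∑ b ∈ I, f b n) :
    ∃ (n : ℕ → ℕ) (I : ℕ → Finset ι), StrictMono n ∧ (∀ k l, k < l → Disjoint (I k) (I l)) ∧
      ∀ k, c / 2 ≤ ∑ b ∈ I k, f b (n k) := by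
  classical
  obtain ⟨g, hg, hgr⟩ := exists_seq_of_forall_finset_exists
    (fun p : ℕ × Finset ι => c / 2 ≤ ∑ b ∈ p.2, f b p.1)
    (fun p q => p.1 < q.1 ∧ Disjoint p.2 q.2) (by
      intro s _
      let U := s.biUnion Prod.snd
      have hU : Tendsto (fun n => ∑ b ∈ U, f b n) atTop (𝓝 0) := by
        simpa using tendsto_finsetSum U fun b _ => h0 b
      obtain ⟨n, hn, hns⟩ := ((hU.eventually_lt_const (half_pos hc)).and
        (eventually_gt_atTop (s.sup Prod.fst))).exists
      obtain ⟨I, hIn⟩ := hI n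
      refine ⟨(n, I \ U), ?_, fun p hp => ⟨(Finset.le_sup (f := Prod.fst) hp).trans_lt hns, ?_⟩⟩
      · have h1 := Finset.sum_inter_add_sum_sdiff I U fun b => f b n
        have h2 : ∑ b ∈ I ∩ U, f b n ≤ ∑ b ∈ U, f b n :=
          Finset.sum_le_sum_of_subset_of_nonneg Finset.inter_subset_right fun b _ _ => hf b n
        change c / 2 ≤ ∑ b ∈ I \ U, f b n
        linarith
      · exact Finset.disjoint_sdiff.mono_left (Finset.subset_biUnion_of_mem Prod.snd hp))
  exact ⟨fun k => (g k).1, fun k => (g k).2, strictMono_nat_of_lt_succ fun k =>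
    (hgr k _ k.lt_succ_self).1, fun k l h => (hgr k l h).2, hg⟩

/-- A sum dominated geometrically away from one large term is large. -/
theorem le_norm_of_hasSum {a : ℕ → ℂ} {S : ℂ} (h : HasSum a S) {k : ℕ} {A B : ℝ}
    (hk : A ≤ ‖a k‖) (hj : ∀ j, j ≠ k → ‖a j‖ ≤ B * (1 / 2) ^ j) (hB : 0 ≤ B) :
    A - 2 * B ≤ ‖S‖ := by
  classical
  have h1 := h.update k 0
  have h2 : ‖0 - a k + S‖ ≤ B * 2 :=
    h1.norm_le_of_bounded (hasSum_geometric_two.mul_left B) fun j => by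
      by_cases hjk : j = k
      · subst hjk
        simp only [Function.update_self, norm_zero]
        positivity
      · rw [Function.update_of_ne hjk]
        exact hj j hjk
  have h3 : ‖a k‖ ≤ ‖S‖ + ‖0 - a k + S‖ := by
    have := norm_sub_le S (0 - a k + S)
    simpa using this
  linarith

section WeaklyNull

variable {X : Type} {𝒳 : LFCMSpace X} {H : Type}
  [NormedAddCommGroup H] [InnerProductSpace ℂ H] [CompleteSpace H] {M : CoarseModule 𝒳 H}

/-- An orthonormal sequence on which all approximable operators are asymptotically diagonal
leaves every bounded set. -/
theorem tendsto_norm_proj {v : ℕ → H} (hv : Orthonormal ℂ v)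
    (ht : ∀ t : H →L[ℂ] H, Approximable 𝒳 M.proj M.proj t → ∀ ε, 0 < ε →
      ∃ N, ∀ m n, N ≤ m → m < n → ‖inner ℂ (v m) (t (v n))‖ < ε)
    {W : Set X} (hW : W ∈ 𝒳.meas) (hWb : 𝒳.coarse.IsBounded W) :
    Tendsto (fun n => ‖M.proj W (v n)‖) atTop (𝓝 0) := by
  classical
  by_contra hcon
  rw [Metric.tendsto_atTop] at hcon
  push Not at hcon
  obtain ⟨δ, hδ, hfreq⟩ := hcon
  simp only [dist_zero_right, norm_norm] at hfreq
  have hweak : ∀ y : H, Tendsto (fun n => ‖inner ℂ y (v n)‖) atTop (𝓝 0) := by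
    intro y
    have h1 := ((hv.inner_products_summable (x := y)).tendsto_atTop_zero).sqrt
    simp only [Real.sqrt_zero] at h1
    refine h1.congr fun n => ?_
    rw [Real.sqrt_sq (norm_nonneg _), norm_inner_symm]
  set η := δ ^ 2 / 2 with hη
  have hη0 : 0 < η := by positivity
  obtain ⟨g, hg, hgr⟩ := exists_seq_of_forall_finset_exists
    (fun p : ℕ × ℕ => δ ≤ ‖M.proj W (v p.2)‖)
    (fun p q => p.1 < q.1 ∧ p.2 < q.2 ∧
      ‖inner ℂ (M.proj W (v p.2)) (v q.2)‖ ≤ η * (1 / 2) ^ q.1) (by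
      intro s _
      have h1 : ∀ᶠ n in atTop, ∀ p ∈ s,
          p.2 < n ∧ ‖inner ℂ (M.proj W (v p.2)) (v n)‖ ≤ η * (1 / 2) ^ (s.sup Prod.fst + 1) := by
        rw [Finset.eventually_all]
        exact fun p _ => (eventually_gt_atTop p.2).and
          ((hweak _).eventually_le_const (by positivity))
      obtain ⟨N, hN⟩ := eventually_atTop.1 h1
      obtain ⟨n, hn, hδn⟩ := hfreq N
      exact ⟨(s.sup Prod.fst + 1, n), hδn, fun p hp =>
        ⟨Nat.lt_succ_of_le (Finset.le_sup (f := Prod.fst) hp), (hN n hn p hp).1,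
          (hN n hn p hp).2⟩⟩)
  have hk : ∀ i, i ≤ (g i).1 := fun i => StrictMono.le_apply (f := fun i => (g i).1)
    (strictMono_nat_of_lt_succ fun i => (hgr i _ i.lt_succ_self).1)
  have hmono : StrictMono fun i => (g i).2 :=
    strictMono_nat_of_lt_succ fun i => (hgr i _ i.lt_succ_self).2.1
  set x : ℕ → H := fun i => v (g i).2 with hx
  have hxo : Orthonormal ℂ x := hv.comp _ hmono.injective
  have hlt : ∀ {i j l}, i < j → l ≤ j → ‖inner ℂ (M.proj W (x i)) (x j)‖ ≤ η * (1 / 2) ^ l := by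
    intro i j l hij hlj
    refine (hgr i j hij).2.2.trans ?_
    gcongr ?_ * ?_
    exact pow_le_pow_of_le_one (by norm_num) (by norm_num) (hlj.trans (hk j))
  have hne : ∀ {i j l}, i ≠ j → (l ≤ i ∨ l ≤ j) →
      ‖inner ℂ (M.proj W (x i)) (x j)‖ ≤ η * (1 / 2) ^ l := by
    intro i j l hij hl
    rcases hij.lt_or_gt with h | h
    · exact hlt h (by omega)
    · rw [M.inner_proj hW, norm_inner_symm]
      exact hlt h (by omega)
  have hodd : Function.Injective fun j : ℕ => 2 * j + 1 := fun a b h => by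
    simp only at h; omega
  have heven : Function.Injective fun j : ℕ => 2 * j := fun a b h => by
    simp only at h; omega
  obtain ⟨T, hT⟩ := exists_hasSum_of_orthonormal (hxo.comp _ hodd) (hxo.comp _ heven)
  obtain ⟨N, hN⟩ := ht _ (approximable_compression hW hWb T) (δ ^ 4 / 2) (by positivity)
  have hN' := hN (g (2 * N)).2 (g (2 * N + 1)).2
    (le_trans (by omega) (hmono.le_apply (x := 2 * N))) (hmono (by omega))
  refine absurd hN' (not_lt.2 ?_)
  change _ ≤ ‖inner ℂ (x (2 * N)) (M.proj W (T (M.proj W (x (2 * N + 1)))))‖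
  rw [← M.inner_proj hW]
  have hS := (innerSL ℂ (M.proj W (x (2 * N)))).hasSum (hT (M.proj W (x (2 * N + 1))))
  have hsq : ∀ i, ‖inner ℂ (x i) (M.proj W (x i))‖ = ‖M.proj W (x i)‖ ^ 2 := by
    intro i
    rw [M.inner_proj_self hW, Complex.norm_real, Real.norm_of_nonneg (by positivity)]
  have hfin := le_norm_of_hasSum hS (k := N) (A := δ ^ 4) (B := η ^ 2) ?_ ?_ (by positivity)
  · rw [innerSL_apply_apply] at hfin
    refine le_trans (le_of_eq ?_) hfin
    rw [hη]; ring
  · simp only [Function.comp_apply, map_smul, innerSL_apply_apply, smul_eq_mul, norm_mul]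
    rw [hsq, M.inner_proj hW, hsq]
    calc δ ^ 4 = δ ^ 2 * δ ^ 2 := by ring
      _ ≤ _ := by gcongr <;> exact hg _
  · intro j hj
    simp only [Function.comp_apply, map_smul, innerSL_apply_apply, smul_eq_mul, norm_mul]
    rw [← M.inner_proj hW]
    have h1 : ‖inner ℂ (M.proj W (x (2 * j + 1))) (x (2 * N + 1))‖ ≤ η * (1 / 2) ^ j :=
      hne (by omega) (Or.inl (by omega))
    have h2 : ‖inner ℂ (M.proj W (x (2 * N))) (x (2 * j))‖ ≤ η * (1 / 2) ^ 0 :=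
      hne (by omega) (Or.inl (by omega))
    rw [pow_zero, mul_one] at h2
    calc _ ≤ (η * (1 / 2) ^ j) * η := by gcongr
      _ = η ^ 2 * (1 / 2) ^ j := by ring

end WeaklyNull

/-! ## Operators out of a faithful module -/

section FaithfulSource

variable {X : Type} {𝒳 : LFCMSpace X} {H K : Type}
  [NormedAddCommGroup H] [InnerProductSpace ℂ H] [CompleteSpace H]
  [NormedAddCommGroup K] [InnerProductSpace ℂ K] [CompleteSpace K]
  {M : CoarseModule 𝒳 H} {N : CoarseModule 𝒳 K}

/-- Every block is uniformly close to a block charged by a given faithful module. -/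
theorem IsFaithfulMod.exists_block_map (hM : IsFaithfulMod 𝒳 M) :
    ∃ E ∈ 𝒳.coarse.entourages, ∃ φ : Set X → Set X, ∀ a ∈ 𝒳.partition,
      φ a ∈ 𝒳.partition ∧ M.proj (φ a) ≠ 0 ∧ a ×ˢ φ a ⊆ E := by
  obtain ⟨E, hE, hdom⟩ := M.isFaithfulMod_iff.1 hM
  have h : ∀ a : Set X, ∃ b, a ∈ 𝒳.partition → b ∈ 𝒳.partition ∧ M.proj b ≠ 0 ∧
      a ×ˢ b ⊆ RelComp 𝒳.disc (RelComp E 𝒳.disc) := by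
    intro a
    by_cases ha : a ∈ 𝒳.partition
    · obtain ⟨x, hx⟩ := 𝒳.isPartition.nonempty a ha
      obtain ⟨y, hy, hxy⟩ := hdom (Set.mem_univ x)
      obtain ⟨B, hB, hBne, hyB⟩ := M.mem_domKappa_one.1 hy
      obtain ⟨b, hb, hyb⟩ := 𝒳.exists_block y
      have hBb : B ⊆ b := by
        intro z hz
        obtain ⟨b', hb', hyb', hzb'⟩ := 𝒳.mem_disc.1 (hB.2 ⟨hyB, hz⟩)
        rwa [𝒳.block_eq hb hb' hyb hyb']
      refine ⟨b, fun _ => ⟨hb, fun h0 => hBne ?_, 𝒳.prod_subset_disc_comp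
        (𝒳.isDiscBounded_of_mem_partition ha) (𝒳.isDiscBounded_of_mem_partition hb) hx hyb hxy⟩⟩
      ext v
      rw [← M.proj_proj_of_subset hB.1 (𝒳.isPartition.measurable hb) hBb, h0]
      simp
    · exact ⟨∅, fun h => absurd h ha⟩
  choose φ hφ using h
  exact ⟨_, 𝒳.disc_comp_mem hE, φ, hφ⟩

/-- The union of the blocks close to `b` with respect to a map of blocks. -/
def blockFiber (𝒳 : LFCMSpace X) (φ : Set X → Set X) (b : Set X) : Set X :=
  ⋃ a ∈ {a | a ∈ 𝒳.partition ∧ φ a = b}, a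

theorem blockFiber_prod_subset {φ : Set X → Set X} {E : Set (X × X)}
    (hφ : ∀ a ∈ 𝒳.partition, a ×ˢ φ a ⊆ E) (b : Set X) : blockFiber 𝒳 φ b ×ˢ b ⊆ E := by
  rintro ⟨x, y⟩ ⟨hx, hy⟩
  obtain ⟨a, ⟨ha, rfl⟩, hxa⟩ := Set.mem_iUnion₂.1 hx
  exact hφ a ha ⟨hxa, hy⟩

theorem isBounded_blockFiber {φ : Set X → Set X} {E : Set (X × X)}
    (hE : E ∈ 𝒳.coarse.entourages) (hφ : ∀ a ∈ 𝒳.partition, a ×ˢ φ a ⊆ E) {b : Set X}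
    (hb : b ∈ 𝒳.partition) : 𝒳.coarse.IsBounded (blockFiber 𝒳 φ b) := by
  obtain ⟨y, hy⟩ := 𝒳.isPartition.nonempty b hb
  refine ⟨_, 𝒳.coarse.comp_mem hE (𝒳.coarse.transpose_mem hE), ?_⟩
  exact fun p hp => ⟨y, blockFiber_prod_subset hφ b ⟨hp.1, hy⟩,
    blockFiber_prod_subset hφ b ⟨hp.2, hy⟩⟩

theorem blockFiber_mem {φ : Set X → Set X} {E : Set (X × X)}
    (hE : E ∈ 𝒳.coarse.entourages) (hφ : ∀ a ∈ 𝒳.partition, a ×ˢ φ a ⊆ E) {b : Set X}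
    (hb : b ∈ 𝒳.partition) : blockFiber 𝒳 φ b ∈ 𝒳.meas := by
  have hfin : {a | a ∈ 𝒳.partition ∧ φ a = b}.Finite := by
    refine (𝒳.isPartition.locallyFinite _ (isBounded_blockFiber hE hφ hb)).subset ?_
    rintro a ⟨ha, hab⟩
    obtain ⟨x, hx⟩ := 𝒳.isPartition.nonempty a ha
    exact ⟨ha, x, hx, Set.mem_iUnion₂.2 ⟨a, ⟨ha, hab⟩, hx⟩⟩
  have h := 𝒳.biUnion_mem hfin.toFinset (W := fun a => a) fun a ha =>
    𝒳.isPartition.measurable (hfin.mem_toFinset.1 ha).1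
  simp only [Set.Finite.mem_toFinset] at h
  exact h

theorem disjoint_blockFiber {φ : Set X → Set X} {b b' : Set X} (h : b ≠ b') :
    Disjoint (blockFiber 𝒳 φ b) (blockFiber 𝒳 φ b') := by
  refine Set.disjoint_left.2 fun x hx hx' => h ?_
  obtain ⟨a, ⟨ha, rfl⟩, hxa⟩ := Set.mem_iUnion₂.1 hx
  obtain ⟨a', ⟨ha', rfl⟩, hxa'⟩ := Set.mem_iUnion₂.1 hx'
  rw [𝒳.block_eq ha ha' hxa hxa']

/-- A unit vector has at least half of its mass in finitely many fibers of a map of blocks. -/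
theorem CoarseModule.exists_half_le_sum_blockFiber (N : CoarseModule 𝒳 K)
    {φ : Set X → Set X} {E : Set (X × X)}
    {p : Set X → Prop} (hE : E ∈ 𝒳.coarse.entourages) (hφ : ∀ a ∈ 𝒳.partition, a ×ˢ φ a ⊆ E)
    (hp : ∀ a ∈ 𝒳.partition, φ a ∈ 𝒳.partition ∧ p (φ a)) {v : K} (hv : ‖v‖ = 1) :
    ∃ I : Finset {b : Set X // b ∈ 𝒳.partition ∧ p b},
      1 / 2 ≤ ∑ b ∈ I, ‖N.proj (blockFiber 𝒳 φ b) v‖ ^ 2 := by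
  classical
  obtain ⟨𝓕, h𝓕, hlt⟩ := N.exists_finset_blocks v (ε := 1 / 4) (by norm_num)
  let I : Finset {b : Set X // b ∈ 𝒳.partition ∧ p b} := 𝓕.attach.image fun a =>
    ⟨φ a.1, hp a.1 (h𝓕 a.1 a.2)⟩
  have hWm : ∀ b ∈ I, blockFiber 𝒳 φ b ∈ 𝒳.meas := fun b _ => blockFiber_mem hE hφ b.2.1
  have h1 : (⋃ A ∈ 𝓕, A) ∈ 𝒳.meas :=
    𝒳.biUnion_mem 𝓕 fun A hA => 𝒳.isPartition.measurable (h𝓕 A hA)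
  have h2 : (⋃ b ∈ I, blockFiber 𝒳 φ b) ∈ 𝒳.meas := 𝒳.biUnion_mem I hWm
  have h3 : (⋃ A ∈ 𝓕, A) ⊆ ⋃ b ∈ I, blockFiber 𝒳 φ b := by
    refine Set.iUnion₂_subset fun A hA x hx => ?_
    exact Set.mem_iUnion₂.2 ⟨⟨φ A, hp A (h𝓕 A hA)⟩,
      Finset.mem_image.2 ⟨⟨A, hA⟩, Finset.mem_attach _ _, rfl⟩,
      Set.mem_iUnion₂.2 ⟨A, ⟨h𝓕 A hA, rfl⟩, hx⟩⟩
  refine ⟨I, ?_⟩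
  rw [N.sum_norm_sq_proj I hWm fun b _ b' _ h =>
    disjoint_blockFiber fun h' => h (Subtype.ext h')]
  have h4 := N.norm_proj_le h1 (N.proj (⋃ b ∈ I, blockFiber 𝒳 φ b) v)
  rw [N.proj_proj_of_subset h1 h2 h3] at h4
  have h5 := norm_sub_norm_le v (N.proj (⋃ A ∈ 𝓕, A) v)
  rw [hv] at h5
  nlinarith

/-- Out of a faithful module, a single nonzero vector is detected by approximable operators. -/
theorem IsFaithfulMod.exists_adjoint_ne_zero (hM : IsFaithfulMod 𝒳 M) {v : K} (hv : v ≠ 0) :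
    ∃ s : H →L[ℂ] K, Approximable 𝒳 M.proj N.proj s ∧ ContinuousLinearMap.adjoint s v ≠ 0 := by
  obtain ⟨E, hE, φ, hφ⟩ := hM.exists_block_map
  obtain ⟨a, ha, hav⟩ : ∃ a ∈ 𝒳.partition, N.proj a v ≠ 0 := by
    by_contra! hc
    exact hv (N.map_eq_zero_of_forall_block (t := ContinuousLinearMap.id ℂ K) hc)
  obtain ⟨hb, hbne, hab⟩ := hφ a ha
  have ham := 𝒳.isPartition.measurable ha
  have hbm := 𝒳.isPartition.measurable hb
  obtain ⟨c, hc, hbc⟩ := M.exists_unit_of_proj_ne_zero hbm hbne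
  refine ⟨rankOne ℂ (N.proj a v) c, approximable_rankOne hE hbm ham hbc (N.proj_idem ham v) hab,
    ?_⟩
  rw [adjoint_rankOne, rankOne_apply, N.inner_proj ham, N.inner_proj_self ham]
  have hc0 : c ≠ 0 := norm_ne_zero_iff.1 (by rw [hc]; exact one_ne_zero)
  refine smul_ne_zero ?_ hc0
  simpa using hav

/-- An operator recovering the components of each `v k` in the `k`-th of a sequence of disjoint
finite families of sets. -/
theorem exists_approximable_of_disjoint {ι : Type} {E : Set (X × X)}
    (hE : E ∈ 𝒳.coarse.entourages) {b W : ι → Set X} (hb : ∀ i, b i ∈ 𝒳.meas)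
    (hW : ∀ i, W i ∈ 𝒳.meas) (hbd : ∀ i j, i ≠ j → Disjoint (b i) (b j))
    (hWd : ∀ i j, i ≠ j → Disjoint (W i) (W j)) (hWb : ∀ i, W i ×ˢ b i ⊆ E) {c : ι → H}
    (hc : ∀ i, ‖c i‖ = 1) (hbc : ∀ i, M.proj (b i) (c i) = c i) {I : ℕ → Finset ι}
    (hI : ∀ k l, k < l → Disjoint (I k) (I l)) (v : ℕ → K) :
    ∃ s : H →L[ℂ] K, Approximable 𝒳 M.proj N.proj s ∧
      ∀ k, ∑ i ∈ I k, ‖N.proj (W i) (v k)‖ ^ 2 ≤ ‖ContinuousLinearMap.adjoint s (v k)‖ ^ 2 := by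
  classical
  let w : ℕ × ι → K := fun p => N.proj (W p.2) (v p.1)
  have hw : ∀ p, N.proj (W p.2) (w p) = w p := fun p => N.proj_idem (hW _) _
  let pJ : ℕ × ι → Prop := fun p => p.2 ∈ I p.1 ∧ w p ≠ 0
  let u : {p // pJ p} → K := fun p => ((‖w p‖⁻¹ : ℝ) : ℂ) • w p
  have hu : ∀ p, N.proj (W p.1.2) (u p) = u p := fun p => by
    simp only [u, map_smul, hw]
  have hne : ∀ {p q : {p // pJ p}}, p ≠ q → p.1.2 ≠ q.1.2 := by
    intro p q hpq h
    have hp := p.2.1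
    have hq := q.2.1
    rw [h] at hp
    rcases lt_trichotomy p.1.1 q.1.1 with h1 | h1 | h1
    · exact Finset.disjoint_left.1 (hI _ _ h1) hp hq
    · exact hpq (Subtype.ext (Prod.ext h1 h))
    · exact Finset.disjoint_left.1 (hI _ _ h1) hq hp
  have hco : Orthonormal ℂ fun p : {p // pJ p} => c p.1.2 :=
    ⟨fun p => hc _, fun p q hpq =>
      M.inner_eq_zero_of_disjoint (hb _) (hb _) (hbd _ _ (hne hpq)) (hbc _) (hbc _)⟩
  have huo : Orthonormal ℂ u := by
    refine ⟨fun p => ?_, fun p q hpq => N.inner_eq_zero_of_disjoint (hW _) (hW _)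
      (hWd _ _ (hne hpq)) (hu p) (hu q)⟩
    simp only [u, norm_smul, Complex.norm_real, norm_inv, norm_norm]
    exact inv_mul_cancel₀ (norm_ne_zero_iff.2 p.2.2)
  obtain ⟨s, hs⟩ := exists_hasSum_of_orthonormal hco huo
  refine ⟨s, approximable_of_hasSum (J := {p // pJ p}) (b := fun p => b p.1.2)
    (W := fun p => W p.1.2) hE (fun p : {p // pJ p} => hb p.1.2) (fun p : {p // pJ p} => hW p.1.2)
    (fun p : {p // pJ p} => hbc p.1.2) hu (fun p : {p // pJ p} => hWb p.1.2) hs, fun k => ?_⟩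
  let S : Finset (ℕ × ι) := ((I k).filter fun i => w (k, i) ≠ 0).image (Prod.mk k)
  have hS : ∀ p ∈ S, pJ p := by
    intro p hp
    obtain ⟨i, hi, rfl⟩ := Finset.mem_image.1 hp
    exact Finset.mem_filter.1 hi
  refine le_trans (le_of_eq ?_)
    (sum_norm_inner_sq_le_norm_adjoint_sq hco hs (v k) (S.subtype pJ))
  have h1 : ∀ p ∈ S.subtype pJ, ‖inner ℂ (u p) (v k)‖ ^ 2 = ‖w p‖ ^ 2 := by
    intro p hp
    obtain ⟨i, -, hi⟩ := Finset.mem_image.1 (Finset.mem_subtype.1 hp)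
    have hw0 : ‖w p‖ ≠ 0 := norm_ne_zero_iff.2 p.2.2
    have h2 : inner ℂ (w p) (v k) = ((‖w p‖ ^ 2 : ℝ) : ℂ) := by
      have := N.inner_proj_self (hW i) (v k)
      rw [← N.inner_proj (hW i)] at this
      rw [← hi]
      exact this
    simp only [u, inner_smul_left, h2, norm_mul, RCLike.norm_conj, Complex.norm_real, norm_inv,
      norm_norm, norm_pow]
    field_simp
  rw [Finset.sum_congr rfl h1, Finset.sum_subtype_of_mem (fun p => ‖w p‖ ^ 2) hS,
    Finset.sum_image fun a _ b _ h => (Prod.mk.inj h).2, Finset.sum_filter_of_ne]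
  intro i _ hi h0
  simp [h0] at hi

/-- Out of a faithful module, a sequence of unit vectors leaving all bounded sets is detected
by a single approximable operator. -/
theorem IsFaithfulMod.exists_not_tendsto (hM : IsFaithfulMod 𝒳 M) {v : ℕ → K}
    (hv : ∀ n, ‖v n‖ = 1)
    (hW : ∀ W ∈ 𝒳.meas, 𝒳.coarse.IsBounded W →
      Tendsto (fun n => ‖N.proj W (v n)‖) atTop (𝓝 0)) :
    ∃ s : H →L[ℂ] K, Approximable 𝒳 M.proj N.proj s ∧
      ¬ Tendsto (fun n => ‖ContinuousLinearMap.adjoint s (v n)‖) atTop (𝓝 0) := by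
  classical
  obtain ⟨E, hE, φ, hφ⟩ := hM.exists_block_map
  have hφE : ∀ a ∈ 𝒳.partition, a ×ˢ φ a ⊆ E := fun a ha => (hφ a ha).2.2
  let ι := {b : Set X // b ∈ 𝒳.partition ∧ M.proj b ≠ 0}
  let W : ι → Set X := fun b => blockFiber 𝒳 φ b
  have hWm : ∀ b, W b ∈ 𝒳.meas := fun b => blockFiber_mem hE hφE b.2.1
  have hbm : ∀ b : ι, b.1 ∈ 𝒳.meas := fun b => 𝒳.isPartition.measurable b.2.1
  have hWd : ∀ b b' : ι, b ≠ b' → Disjoint (W b) (W b') := fun _ _ h =>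
    disjoint_blockFiber fun h' => h (Subtype.ext h')
  choose c hc hbc using fun b : ι => M.exists_unit_of_proj_ne_zero (hbm b) b.2.2
  obtain ⟨n, I, hn, hdisj, hmass⟩ := exists_disjoint_humps (c := 1 / 2)
    (f := fun (b : ι) n => ‖N.proj (W b) (v n)‖ ^ 2)
    (fun b n => by positivity)
    (fun b => by
      simpa using (hW _ (hWm b) (isBounded_blockFiber hE hφE b.2.1)).pow 2)
    (by norm_num) (fun n => by
      exact N.exists_half_le_sum_blockFiber (p := fun b => M.proj b ≠ 0) hE hφE
        (fun a ha => ⟨(hφ a ha).1, (hφ a ha).2.1⟩) (hv n))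
  obtain ⟨s, hs, hlow⟩ := exists_approximable_of_disjoint (N := N) hE hbm hWm
    (fun b b' h => 𝒳.isPartition.pairwiseDisjoint _ b.2.1 _ b'.2.1 fun h' => h (Subtype.ext h'))
    hWd (fun b => blockFiber_prod_subset hφE b) hc hbc hdisj fun k => v (n k)
  refine ⟨s, hs, fun hlim => ?_⟩
  have h3 := ge_of_tendsto' ((hlim.comp hn.tendsto_atTop).pow 2)
    fun k => (hmass k).trans (hlow k)
  norm_num at h3

end FaithfulSource

/-! ## Vectors localized far from the source or from each other -/

section Localized

variable {X : Type} {𝒳 : LFCMSpace X} {H K : Type}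
  [NormedAddCommGroup H] [InnerProductSpace ℂ H] [CompleteSpace H]
  [NormedAddCommGroup K] [InnerProductSpace ℂ K] [CompleteSpace K]
  {M : CoarseModule 𝒳 H} {N : CoarseModule 𝒳 K}

/-- The adjoint of an operator kills vectors localized far from the domain of its source. -/
theorem adjoint_eq_zero_of_notMem_nbhd {t : H →L[ℂ] K} {B : Set X} (hB : 𝒳.IsDiscBounded B)
    {w : K} (hw : N.proj B w = w) {z : X} (hz : z ∈ B)
    (hzt : z ∉ CoarseSpace.nbhd (opSupp 𝒳 𝒳 M.proj N.proj t) (domKappa 𝒳 M 1)) :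
    ContinuousLinearMap.adjoint t w = 0 := by
  refine M.map_eq_zero_of_forall_block (t := ContinuousLinearMap.id ℂ H) fun A hA => ?_
  by_contra hne
  set v := ContinuousLinearMap.adjoint t w
  have hA' := 𝒳.isDiscBounded_of_mem_partition hA
  change M.proj A v ≠ 0 at hne
  obtain ⟨x, hx⟩ := 𝒳.isPartition.nonempty A hA
  refine hzt ⟨x, M.mem_domKappa_one.2 ⟨A, hA', fun h => hne (by rw [h]; rfl), hx⟩,
    prod_subset_opSupp hB hA' (v := v) (fun h => hne ?_) ⟨hz, hx⟩⟩
  have h1 : inner ℂ (M.proj A v) v = (0 : ℂ) := by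
    rw [ContinuousLinearMap.adjoint_inner_right, ← hw, ← N.inner_proj hB.1, h, inner_zero_left]
  rw [← inner_self_eq_zero (𝕜 := ℂ), M.inner_proj hA'.1, M.proj_idem hA'.1, ← M.inner_proj hA'.1,
    h1]

theorem Approximable.exists_norm_adjoint_le {t : H →L[ℂ] K}
    (ht : Approximable 𝒳 M.proj N.proj t) {ε : ℝ} (hε : 0 < ε) :
    ∃ E ∈ 𝒳.coarse.entourages, ∀ B w z, 𝒳.IsDiscBounded B → N.proj B w = w → ‖w‖ = 1 → z ∈ B →
      z ∉ CoarseSpace.nbhd E (domKappa 𝒳 M 1) → ‖ContinuousLinearMap.adjoint t w‖ ≤ ε := by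
  obtain ⟨s, hs, hts⟩ := ht ε hε
  refine ⟨_, hs, fun B w z hB hw hw1 hz hzE => ?_⟩
  have h := (ContinuousLinearMap.adjoint (t - s)).le_opNorm w
  rw [LinearIsometryEquiv.norm_map, hw1, mul_one, map_sub, sub_apply,
    adjoint_eq_zero_of_notMem_nbhd hB hw hz hzE, sub_zero] at h
  exact h.trans hts

theorem Approximable.exists_norm_inner_le {t : H →L[ℂ] H}
    (ht : Approximable 𝒳 M.proj M.proj t) {ε : ℝ} (hε : 0 < ε) :
    ∃ E ∈ 𝒳.coarse.entourages, ∀ B B' w w' z z', 𝒳.IsDiscBounded B → 𝒳.IsDiscBounded B' →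
      M.proj B w = w → M.proj B' w' = w' → ‖w‖ = 1 → ‖w'‖ = 1 → z ∈ B → z' ∈ B' → (z, z') ∉ E →
      ‖inner ℂ w (t w')‖ ≤ ε := by
  obtain ⟨s, hs, hts⟩ := ht ε hε
  refine ⟨_, hs, fun B B' w w' z z' hB hB' hw hw' hw1 hw1' hz hz' hE => ?_⟩
  have h0 : inner ℂ w (s w') = (0 : ℂ) := by
    rw [← hw, M.inner_proj hB.1, ← hw', not_ne_iff.1 fun h =>
      hE (prod_subset_opSupp hB hB' (v := w') h ⟨hz, hz'⟩), inner_zero_right]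
  calc ‖inner ℂ w (t w')‖ = ‖inner ℂ w ((t - s) w')‖ := by
        rw [sub_apply, inner_sub_right, h0, sub_zero]
    _ ≤ ‖w‖ * ‖(t - s) w'‖ := norm_inner_le_norm _ _
    _ ≤ ‖w‖ * (‖t - s‖ * ‖w'‖) := by gcongr; exact (t - s).le_opNorm w'
    _ ≤ ε := by rwa [hw1, hw1', one_mul, mul_one]

end Localized

/-! ## Domains of images of faithful modules -/

namespace StarFunctor

variable {X Y : Type} {𝒳 : LFCMSpace X} {𝒴 : LFCMSpace Y} {F : StarFunctor 𝒳 𝒴}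

/-- Each point of the domain of `F D` carries a unit vector coming from a unit vector of `D`. -/
theorem exists_localized_unit (hfull : F.Full) (hF : F.Faithful) {D : BundledModule 𝒳} {z : Y}
    (hz : z ∈ domKappa 𝒴 (F.obj D).mod 1) :
    ∃ (B : Set Y) (w : (F.obj D).H) (v : D.H), 𝒴.IsDiscBounded B ∧ z ∈ B ∧ ‖w‖ = 1 ∧
      (F.obj D).mod.proj B w = w ∧ ‖v‖ = 1 ∧
      ∃ hv : Approximable 𝒳 D.mod.proj D.mod.proj (rankOne ℂ v v),
        F.map (rankOne ℂ v v) hv = rankOne ℂ w w := by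
  obtain ⟨B, hB, hne, hzB⟩ := (F.obj D).mod.mem_domKappa_one.1 hz
  obtain ⟨w, hw1, hw⟩ := (F.obj D).mod.exists_unit_of_proj_ne_zero hB.1 hne
  obtain ⟨v, hv1, hv⟩ := exists_rankOne_preimage hfull hF hw1
    (approximable_rankOne 𝒴.disc_mem hB.1 hB.1 hw hw hB.2)
  exact ⟨B, w, v, hB, hzB, hw1, hw, hv1, hv⟩

theorem exists_mem_nbhd (hfull : F.Full) (hF : F.Faithful) {C D : BundledModule 𝒳}
    (hC : IsFaithfulMod 𝒳 C.mod) {z : Y} (hz : z ∈ domKappa 𝒴 (F.obj D).mod 1) :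
    ∃ E ∈ 𝒴.coarse.entourages, z ∈ CoarseSpace.nbhd E (domKappa 𝒴 (F.obj C).mod 1) := by
  by_contra! hcon
  obtain ⟨B, w, v, hB, hzB, hw1, hw, hv1, hv, hvw⟩ := exists_localized_unit hfull hF hz
  obtain ⟨s, hs, hsv⟩ := hC.exists_adjoint_ne_zero (N := D.mod) (v := v)
    (norm_ne_zero_iff.1 (by rw [hv1]; exact one_ne_zero))
  obtain ⟨E, hE, hle⟩ := (F.map_approximable s hs).exists_norm_adjoint_le
    (half_pos (norm_pos_iff.2 hsv))
  have h := hle B w z hB hw hw1 hzB (hcon E hE)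
  rw [← norm_adjoint_eq hw1 hvw] at h
  linarith [norm_pos_iff.2 hsv]

/-- If `C` is faithful, the domain of any `F D` is subordinate to that of `F C`. -/
theorem subordinate_domKappa (hY : 𝒴.coarse.IsCountablyGenerated) (hfull : F.Full)
    (hF : F.Faithful) {C : BundledModule 𝒳} (hC : IsFaithfulMod 𝒳 C.mod) (D : BundledModule 𝒳) :
    𝒴.coarse.Subordinate (domKappa 𝒴 (F.obj D).mod 1) (domKappa 𝒴 (F.obj C).mod 1) := by
  classical
  by_contra hnot
  have hfar : ∀ E ∈ 𝒴.coarse.entourages, ∃ z ∈ domKappa 𝒴 (F.obj D).mod 1,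
      z ∉ CoarseSpace.nbhd E (domKappa 𝒴 (F.obj C).mod 1) := fun E hE => by
    by_contra! h
    exact hnot ⟨E, hE, h⟩
  obtain ⟨E, hE, hmono, hdisc, hsymm, hcof⟩ := 𝒴.exists_cofinal_seq hY
  have hnear : ∀ z, ∃ n, z ∈ domKappa 𝒴 (F.obj D).mod 1 →
      ∃ c ∈ domKappa 𝒴 (F.obj C).mod 1, (z, c) ∈ E n := by
    intro z
    by_cases hz : z ∈ domKappa 𝒴 (F.obj D).mod 1
    · obtain ⟨E', hE', c, hc, hzc⟩ := exists_mem_nbhd hfull hF hC hz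
      obtain ⟨n, hn⟩ := hcof E' hE'
      exact ⟨n, fun _ => ⟨c, hc, hn hzc⟩⟩
    · exact ⟨0, fun h => (hz h).elim⟩
  choose r hr using hnear
  obtain ⟨f, hf, hff⟩ := exists_seq_of_forall_finset_exists
    (fun q : ℕ × Y => q.2 ∈ domKappa 𝒴 (F.obj D).mod 1 ∧
      q.2 ∉ CoarseSpace.nbhd (E q.1) (domKappa 𝒴 (F.obj C).mod 1))
    (fun p q => p.1 < q.1 ∧ (q.2, p.2) ∉ E q.1) (by
      intro S hS
      let k := S.sup Prod.fst + 1
      let l := S.sup fun p => r p.2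
      obtain ⟨z, hz, hzE⟩ := hfar (RelComp (E k) (E l) ∪ E k)
        (𝒴.coarse.union_mem (𝒴.coarse.comp_mem (hE k) (hE l)) (hE k))
      refine ⟨(k, z), ⟨hz, fun ⟨c, hc, h⟩ => hzE ⟨c, hc, Or.inr h⟩⟩, fun p hp =>
        ⟨Nat.lt_succ_of_le (Finset.le_sup (f := Prod.fst) hp), fun h => ?_⟩⟩
      obtain ⟨c, hc, hpc⟩ := hr p.2 (hS p hp).1
      exact hzE ⟨c, hc, Or.inl ⟨p.2, h, hmono (Finset.le_sup (f := fun p => r p.2) hp) hpc⟩⟩)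
  have hk : ∀ n, n ≤ (f n).1 := fun n =>
    StrictMono.le_apply (f := fun n => (f n).1) fun m n h => (hff m n h).1
  have hev : ∀ E' ∈ 𝒴.coarse.entourages, ∃ n₀, ∀ n, n₀ ≤ n → E' ⊆ E (f n).1 := fun E' hE' =>
    let ⟨n₀, hn₀⟩ := hcof E' hE'
    ⟨n₀, fun n hn => hn₀.trans (hmono (hn.trans (hk n)))⟩
  choose B w v hB hzB hw1 hw hv1 hv hvw using
    fun n => exists_localized_unit hfull hF (hf n).1
  have hdisj : ∀ m n, m < n → Disjoint (B m) (B n) := fun m n h =>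
    Set.disjoint_left.2 fun x hm hn => (hff m n h).2 <| hdisc _ <|
      𝒴.disc_trans ((hB n).2 ⟨hzB n, hn⟩) ((hB m).2 ⟨hm, hzB m⟩)
  have horth : Orthonormal ℂ v := by
    refine ⟨hv1, fun m n hmn => ?_⟩
    have hd : Disjoint (B m) (B n) :=
      hmn.lt_or_gt.elim (hdisj m n) fun h => (hdisj n m h).symm
    have h := norm_inner_eq (hw1 m) (hvw m) (hv1 n) (hw1 n) (hvw n)
      (approximable_id (M := D.mod))
    rw [F.map_id, ContinuousLinearMap.id_apply, ContinuousLinearMap.id_apply,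
      (F.obj D).mod.inner_eq_zero_of_disjoint (hB m).1 (hB n).1 hd (hw m) (hw n), norm_zero] at h
    exact norm_eq_zero.1 h
  have hoff : ∀ t : D.H →L[ℂ] D.H, Approximable 𝒳 D.mod.proj D.mod.proj t → ∀ ε, 0 < ε →
      ∃ n₀, ∀ m n, n₀ ≤ m → m < n → ‖inner ℂ (v m) (t (v n))‖ < ε := by
    intro t ht ε hε
    obtain ⟨E', hE', hle⟩ := (F.map_approximable t ht).exists_norm_inner_le (half_pos hε)
    obtain ⟨n₀, hn₀⟩ := hev E' hE'
    refine ⟨n₀, fun m n hm hmn => ?_⟩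
    rw [norm_inner_eq (hw1 m) (hvw m) (hv1 n) (hw1 n) (hvw n) ht]
    refine (hle _ _ _ _ _ _ (hB m) (hB n) (hw m) (hw n) (hw1 m) (hw1 n) (hzB m) (hzB n)
      fun h => (hff m n hmn).2 (hsymm _ _ _ (hn₀ n (hm.trans hmn.le) h))).trans_lt
      (half_lt_self hε)
  obtain ⟨s, hs, hlim⟩ := hC.exists_not_tendsto (N := D.mod) hv1
    fun W hW hWb => tendsto_norm_proj horth hoff hW hWb
  refine hlim (Metric.tendsto_atTop.2 fun ε hε => ?_)
  obtain ⟨E', hE', hle⟩ := (F.map_approximable s hs).exists_norm_adjoint_le (half_pos hε)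
  obtain ⟨n₀, hn₀⟩ := hev E' hE'
  refine ⟨n₀, fun n hn => ?_⟩
  rw [dist_zero_right, norm_norm, norm_adjoint_eq (hw1 n) (hvw n) hs]
  exact (hle _ _ _ (hB n) (hw n) (hw1 n) (hzB n)
    fun ⟨c, hc, h⟩ => (hf n).2 ⟨c, hc, hn₀ n hn h⟩).trans_lt (half_lt_self hε)

end StarFunctor

end Preparations

/-- A *-equivalence between approximable categories of countably generated
LFCM spaces containing faithful modules sends faithful modules to faithful modules. -/
theorem starEquivalence_preserves_faithful {X Y : Type}
    (𝒳 : LFCMSpace X) (𝒴 : LFCMSpace Y)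
    (hX : 𝒳.coarse.IsCountablyGenerated) (hY : 𝒴.coarse.IsCountablyGenerated)
    (hfX : ∃ C : BundledModule 𝒳, IsFaithfulMod 𝒳 C.mod)
    (hfY : ∃ D : BundledModule 𝒴, IsFaithfulMod 𝒴 D.mod)
    (F : StarFunctor 𝒳 𝒴) (hfull : F.Full) (hfaithful : F.Faithful) (hes : F.EssSurj)
    (C : BundledModule 𝒳) (hC : IsFaithfulMod 𝒳 C.mod) :
    IsFaithfulMod 𝒴 (F.obj C).mod := by
  rw [CoarseModule.isFaithfulMod_iff]
  obtain ⟨D', hD'⟩ := hfY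
  obtain ⟨D, u, -, v, hv, -, huv⟩ := hes D'
  obtain ⟨E, hE, hdom⟩ := ((F.obj D).mod.isFaithfulMod_iff).1 (hD'.of_leftInverse hv huv)
  obtain ⟨E', hE', hsub⟩ := StarFunctor.subordinate_domKappa hY hfull hfaithful hC D
  refine ⟨_, 𝒴.coarse.comp_mem hE hE', fun y hy => ?_⟩
  obtain ⟨z, hz, hyz⟩ := hdom hy
  obtain ⟨c, hc, hzc⟩ := hsub hz
  exact ⟨c, hc, z, hyz, hzc⟩
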